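/- Let G be a finite group, F an algebraically closed field of characteristic zero, and let L = ⊕_{g∈G} L_g be a finite dimensional G-graded Lie algebra over F. Then: (i) the solvable radical Rad L is a graded ideal of L; (ii) there exists a Levi subalgebra B of L that is a graded subspace of L; and (iii) B decomposes as a direct sum B = H_1 ⊕ ... ⊕ H_m of graded ideals of B, where each H_i is graded simple with respect to the induced grading, the support Supp H_i of each H_i is a commutative subset of G, and each H_i, as an ungraded Lie algebra, is a direct sum of pairwise isomorphic simple ideals. -/

import Mathlib

/-- A `G`-grading on a Lie algebra `L` over `F`: a vector space direct sum decomposition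
`L = ⊕_{g ∈ G} 𝒜 g` such that `⁅𝒜 g, 𝒜 h⁆ ⊆ 𝒜 (g * h)` for all `g h : G`. -/
def IsLieGrading {G F L : Type*} [Group G] [Field F] [LieRing L] [LieAlgebra F L]
    (𝒜 : G → Submodule F L) : Prop :=
  letI : DecidableEq G := Classical.decEq G
  DirectSum.IsInternal 𝒜 ∧
    ∀ g h : G, ∀ x ∈ 𝒜 g, ∀ y ∈ 𝒜 h, ⁅x, y⁆ ∈ 𝒜 (g * h)

/-- A subspace `V` of a `G`-graded Lie algebra is graded (homogeneous) if it is the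
sum of its homogeneous components, i.e. `V = ⊕_{g ∈ G} (V ∩ L_g)`. -/
def IsGradedSubspace {G F L : Type*} [Group G] [Field F] [LieRing L] [LieAlgebra F L]
    (𝒜 : G → Submodule F L) (V : Submodule F L) : Prop :=
  V = ⨆ g : G, 𝒜 g ⊓ V

/-- A `G`-graded Lie algebra is graded simple if `⁅L, L⁆ ≠ 0` and the only graded
ideals of `L` are `0` and `L`. -/
def IsGradedSimple {G F L : Type*} [Group G] [Field F] [LieRing L] [LieAlgebra F L]
    (𝒜 : G → Submodule F L) : Prop :=
  (∃ x y : L, ⁅x, y⁆ ≠ 0) ∧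
    ∀ I : LieIdeal F L, IsGradedSubspace 𝒜 I.toSubmodule → I = ⊥ ∨ I = ⊤

section

open LieAlgebra LieModule

/-- Every ideal of a finite-dimensional Lie algebra with nondegenerate Killing form is perfect. -/
theorem LieIdeal.lie_self_eq_of_isKilling {F S : Type*} [Field F] [LieRing S] [LieAlgebra F S]
    [FiniteDimensional F S] [IsKilling F S] (I : LieIdeal F S) : ⁅I, I⁆ = I := by
  refine le_antisymm (LieSubmodule.lie_le_left _ _) fun x hx => ?_
  have hc := LieIdeal.isCompl_killingCompl ⁅I, I⁆
  set N := ⁅I, I⁆ with hN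
  have hJ : I ⊓ N.killingCompl = ⊥ := by
    have : IsLieAbelian ↥(I ⊓ N.killingCompl) := by
      rw [LieAlgebra.abelian_iff_derived_one_eq_bot]
      rw [LieAlgebra.derivedSeriesOfIdeal_succ, LieAlgebra.derivedSeriesOfIdeal_zero, eq_bot_iff,
        ← hc.inf_eq_bot]
      exact le_inf (LieSubmodule.mono_lie inf_le_left inf_le_left)
        ((LieSubmodule.lie_le_left _ _).trans inf_le_right)
    exact IsKilling.ideal_eq_bot_of_isLieAbelian _
  have hx' : x ∈ N ⊔ N.killingCompl := by rw [hc.sup_eq_top]; trivial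
  obtain ⟨n, hn, m, hm, rfl⟩ := (LieSubmodule.mem_sup _ _ _).1 hx'
  have hmI : m ∈ I := by
    have := I.sub_mem hx (LieSubmodule.lie_le_left I I hn)
    simpa using this
  have : m ∈ I ⊓ N.killingCompl := ⟨hmI, hm⟩
  rw [hJ] at this
  simp only [LieSubmodule.mem_bot] at this
  simpa [this] using hn

instance LieAlgebra.hasTrivialRadical_quotient_radical {F L : Type*} [Field F] [LieRing L]
    [LieAlgebra F L] [FiniteDimensional F L] : HasTrivialRadical F (L ⧸ radical F L) := by
  refine hasTrivialRadical_of_no_solvable_ideals fun I hI => ?_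
  let π : L →ₗ⁅F⁆ L ⧸ radical F L :=
    { (LieSubmodule.Quotient.mk' (radical F L) : L →ₗ[F] L ⧸ radical F L) with
      map_lie' := fun {x y} => rfl }
  have hπ : Function.Surjective π := LieSubmodule.Quotient.surjective_mk' _
  obtain ⟨k, hk⟩ := (isSolvable_iff F I).1 hI
  obtain ⟨l, hl⟩ := (isSolvable_iff F (radical F L)).1 inferInstance
  rw [LieIdeal.derivedSeries_eq_bot_iff] at hk hl
  let J := LieIdeal.comap π I
  have h1 : ∀ n, derivedSeriesOfIdeal F L n J ≤ LieIdeal.comap π (derivedSeriesOfIdeal F _ n I) := by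
    intro n
    induction n with
    | zero => exact le_rfl
    | succ n ih =>
      rw [derivedSeriesOfIdeal_succ, derivedSeriesOfIdeal_succ]
      exact (LieSubmodule.mono_lie ih ih).trans (LieIdeal.comap_bracket_le _)
  have h2 : derivedSeriesOfIdeal F L k J ≤ radical F L := by
    refine (h1 k).trans fun x hx => ?_
    rw [hk, LieIdeal.mem_comap, LieSubmodule.mem_bot] at hx
    exact LieSubmodule.Quotient.mk_eq_zero'.1 hx
  have hJ : IsSolvable J := by
    refine IsSolvable.mk (R := F) (k := l + k) ?_
    rw [LieIdeal.derivedSeries_eq_bot_iff, derivedSeriesOfIdeal_add, eq_bot_iff, ← hl]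
    exact derivedSeriesOfIdeal_mono h2 l
  rw [LieIdeal.solvable_iff_le_radical] at hJ
  rw [eq_bot_iff]
  intro y hy
  obtain ⟨x, rfl⟩ := hπ y
  have : x ∈ radical F L := hJ hy
  exact (LieSubmodule.mem_bot _).2 (LieSubmodule.Quotient.mk_eq_zero'.2 this)

/-- A nilpotent module over a perfect Lie algebra is trivial. -/
theorem LieModule.isTrivial_of_isNilpotent_of_perfect {F K V : Type*} [CommRing F] [LieRing K]
    [LieAlgebra F K] [AddCommGroup V] [Module F V] [LieRingModule K V] [LieModule F K V]
    [LieModule.IsNilpotent K V] (hK : derivedSeries F K 1 = ⊤) : IsTrivial K V := by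
  have key : ∀ n : ℕ, ∀ (x : K) (j : ℕ) (v : V), v ∈ lowerCentralSeries F K V j →
      ⁅x, v⁆ ∈ lowerCentralSeries F K V (j + (n + 1)) := by
    intro n
    induction n with
    | zero =>
      intro x j v hv
      rw [lowerCentralSeries_succ]
      exact LieSubmodule.lie_mem_lie (LieSubmodule.mem_top _) hv
    | succ n ih =>
      intro x
      have hx : x ∈ (⁅(⊤ : LieIdeal F K), (⊤ : LieIdeal F K)⁆ : LieIdeal F K).toSubmodule := by
        have : x ∈ derivedSeries F K 1 := by rw [hK]; trivial
        simpa using this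
      rw [LieSubmodule.lieIdeal_oper_eq_linear_span] at hx
      induction hx using Submodule.span_induction with
      | mem x hx =>
        obtain ⟨⟨y, _⟩, ⟨z, _⟩, rfl⟩ := hx
        intro j v hv
        change ⁅⁅y, z⁆, v⁆ ∈ _
        rw [lie_lie]
        have h : ∀ y z : K, ⁅y, ⁅z, v⁆⁆ ∈ lowerCentralSeries F K V (j + (n + 1 + 1)) := by
          intro y z
          refine antitone_lowerCentralSeries F K V ?_ (ih y _ _ (ih z _ _ hv))
          omega
        exact sub_mem (h y z) (h z y)
      | zero => intro j v _; simp
      | add x y _ _ hx hy =>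
        intro j v hv
        rw [add_lie]
        exact add_mem (hx j v hv) (hy j v hv)
      | smul a x _ hx =>
        intro j v hv
        rw [smul_lie]
        exact SMulMemClass.smul_mem _ (hx j v hv)
  obtain ⟨k, hk⟩ := (LieModule.isNilpotent_iff F K V).1 inferInstance
  refine ⟨fun x v => ?_⟩
  have := antitone_lowerCentralSeries F K V (show k ≤ 0 + (k + 1) by omega)
    (key k x 0 v (by simp))
  rwa [hk, LieSubmodule.mem_bot] at this

/-- Over a semisimple Lie algebra, an element lying in the kernel of the trace form of a
module acts trivially on that module. -/
theorem LieModule.lie_eq_zero_of_traceForm_eq_zero {F S V : Type*} [Field F] [CharZero F]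
    [LieRing S] [LieAlgebra F S] [FiniteDimensional F S] [IsKilling F S] [AddCommGroup V]
    [Module F V] [FiniteDimensional F V] [LieRingModule S V] [LieModule F S V] {x : S}
    (hx : ∀ y, traceForm F S V x y = 0) (v : V) : ⁅x, v⁆ = 0 := by
  let K : LieIdeal F S :=
    { LinearMap.ker (traceForm F S V) with
      lie_mem := by
        intro y z hz
        have hz' : traceForm F S V z = 0 := hz
        change traceForm F S V ⁅y, z⁆ = 0
        ext w
        rw [traceForm_apply_lie_apply', hz']
        simp }
  have hxK : x ∈ K := LinearMap.mem_ker.2 (LinearMap.ext hx)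
  have htf : traceForm F K V = 0 := by
    ext ⟨y, hy⟩ z
    exact LinearMap.congr_fun (show traceForm F S V y = 0 from hy) (z : S)
  have hnil := isNilpotent_derivedSeries_of_traceForm_eq_zero htf
  have hperf : derivedSeries F K 1 = ⊤ := by
    rw [LieIdeal.derivedSeries_eq_derivedSeriesOfIdeal_comap, derivedSeriesOfIdeal_succ,
      derivedSeriesOfIdeal_zero, LieIdeal.lie_self_eq_of_isKilling]
    simp
  have hnilK : LieModule.IsNilpotent K V := by
    rw [LieModule.isNilpotent_iff_forall' (R := F)] at hnil ⊢
    intro y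
    exact hnil ⟨y, by rw [hperf]; trivial⟩
  have := LieModule.isTrivial_of_isNilpotent_of_perfect (F := F) (V := V) hperf
  exact this.trivial ⟨x, hxK⟩ v

attribute [local instance] LieRing.ofAssociativeRing

/-- **Casimir operator**: for a nontrivial module `V` over a semisimple Lie algebra there is a
module endomorphism of `V` with nonzero trace which takes values in `S · V` and annihilates
the invariants. -/
theorem LieModule.exists_casimir {F S V : Type*} [Field F] [CharZero F]
    [LieRing S] [LieAlgebra F S] [FiniteDimensional F S] [IsKilling F S] [AddCommGroup V]
    [Module F V] [FiniteDimensional F V] [LieRingModule S V] [LieModule F S V]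
    (hV : ∃ (x : S) (v : V), ⁅x, v⁆ ≠ 0) :
    ∃ c : Module.End F V, (∀ (x : S) (v : V), c ⁅x, v⁆ = ⁅x, c v⁆) ∧
      (∀ v, c v ∈ Submodule.span F {w : V | ∃ (x : S) (v : V), ⁅x, v⁆ = w}) ∧
      (∀ v : V, (∀ x : S, ⁅x, v⁆ = 0) → c v = 0) ∧ LinearMap.trace F V c ≠ 0 := by
  classical
  let K : LieIdeal F S := (toEnd F S V).ker
  have hc := LieIdeal.isCompl_killingCompl K
  set T : LieIdeal F S := K.killingCompl with hT
  let b : LinearMap.BilinForm F T := (traceForm F S V).restrict T.toSubmodule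
  have hb : ∀ x y : T, b x y = traceForm F S V x y := fun _ _ => rfl
  have hsym : b.IsSymm := ⟨fun x y => traceForm_comm F S V x y⟩
  have hKv : ∀ k ∈ K, ∀ v : V, ⁅k, v⁆ = 0 := fun k hk v =>
    LinearMap.congr_fun ((LieHom.mem_ker).1 hk) v
  have hdecomp : ∀ y : S, ∃ k ∈ K, ∃ t ∈ T, k + t = y := fun y =>
    (LieSubmodule.mem_sup _ _ _).1 (by rw [hc.sup_eq_top]; trivial)
  have hnd : b.Nondegenerate := by
    refine hsym.isRefl.nondegenerate_iff_separatingLeft.2 ?_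
    rintro ⟨x, hx⟩ h
    have hxK : x ∈ K := by
      refine (LieHom.mem_ker).2 (LinearMap.ext fun v => ?_)
      refine lie_eq_zero_of_traceForm_eq_zero (F := F) (V := V) (fun y => ?_) v
      obtain ⟨k, hk, t, ht, rfl⟩ := hdecomp y
      have h1 : traceForm F S V x t = 0 := h ⟨t, ht⟩
      have h2 : traceForm F S V x k = 0 := by
        rw [traceForm_apply_apply, (LieHom.mem_ker).1 hk]
        simp
      rw [map_add, h1, h2, add_zero]
    have : x ∈ K ⊓ T := ⟨hxK, hx⟩
    rw [hc.inf_eq_bot] at this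
    exact Subtype.ext ((LieSubmodule.mem_bot _).1 this)
  let e := Module.finBasis F T
  let f := b.dualBasis hnd e
  have hfe : b.dualBasis hnd f = e := LinearMap.BilinForm.dualBasis_dualBasis hnd hsym e
  have hexp : ∀ x : T, x = ∑ j, b x (f j) • e j := fun x => by
    have h := (b.dualBasis hnd f).sum_repr x
    simp_rw [LinearMap.BilinForm.dualBasis_repr_apply, hfe] at h
    exact h.symm
  have hfxp : ∀ x : T, x = ∑ j, b x (e j) • f j := fun x => by
    have h := f.sum_repr x
    simp_rw [f, LinearMap.BilinForm.dualBasis_repr_apply] at h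
    exact h.symm
  have hinv : ∀ (s : S) (x y : T), b ⁅s, x⁆ y = - b ⁅s, y⁆ x := fun s x y => by
    simp only [hb]
    rw [traceForm_comm F S V _ (x : S)]
    exact traceForm_apply_lie_apply' F S V s x y
  have hlsum : ∀ (a : Fin (Module.finrank F T) → F) (g : Fin (Module.finrank F T) → T) (v : V),
      ⁅((∑ j, a j • g j : T) : S), v⁆ = ∑ j, a j • ⁅(g j : S), v⁆ := fun a g v => by
    have h : ((∑ j, a j • g j : T) : S) = ∑ j, a j • (g j : S) := by
      exact map_sum T.toSubmodule.subtype _ _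
    rw [h, sum_lie]
    simp_rw [smul_lie]
  let c : Module.End F V := ∑ i, toEnd F S V (e i) * toEnd F S V (f i)
  have hcv : ∀ v, c v = ∑ i, ⁅(e i : S), ⁅(f i : S), v⁆⁆ := fun v => by
    simp [c, LinearMap.sum_apply]
  refine ⟨c, fun s v => ?_, fun v => ?_, fun v hv => ?_, ?_⟩
  · rw [hcv, hcv, lie_sum]
    have h1 : ∀ i, ⁅s, ⁅(e i : S), ⁅(f i : S), v⁆⁆⁆ = ⁅((⁅s, e i⁆ : T) : S), ⁅(f i : S), v⁆⁆ +
        ⁅(e i : S), ⁅((⁅s, f i⁆ : T) : S), v⁆⁆ + ⁅(e i : S), ⁅(f i : S), ⁅s, v⁆⁆⁆ := fun i => by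
      rw [LieSubmodule.coe_bracket, LieSubmodule.coe_bracket, leibniz_lie s (e i : S),
        leibniz_lie s (f i : S), lie_add, add_assoc]
    simp_rw [h1, Finset.sum_add_distrib]
    rw [right_eq_add]
    have h2 : ∑ i, ⁅((⁅s, e i⁆ : T) : S), ⁅(f i : S), v⁆⁆ =
        ∑ i, ∑ j, b ⁅s, e i⁆ (f j) • ⁅(e j : S), ⁅(f i : S), v⁆⁆ := by
      refine Finset.sum_congr rfl fun i _ => ?_
      conv_lhs => rw [hexp ⁅s, e i⁆]
      rw [hlsum]
    have h3 : ∑ i, ⁅(e i : S), ⁅((⁅s, f i⁆ : T) : S), v⁆⁆ =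
        ∑ i, ∑ j, b ⁅s, f i⁆ (e j) • ⁅(e i : S), ⁅(f j : S), v⁆⁆ := by
      refine Finset.sum_congr rfl fun i _ => ?_
      conv_lhs => rw [hfxp ⁅s, f i⁆]
      rw [hlsum, lie_sum]
      simp_rw [lie_smul]
    rw [h2, h3, Finset.sum_comm, ← Finset.sum_add_distrib]
    refine Finset.sum_eq_zero fun i _ => ?_
    rw [← Finset.sum_add_distrib]
    refine Finset.sum_eq_zero fun j _ => ?_
    rw [hinv s (f i) (e j), ← add_smul]
    simp
  · rw [hcv]
    exact Submodule.sum_mem _ fun i _ => Submodule.subset_span ⟨_, _, rfl⟩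
  · rw [hcv]
    simp [hv]
  · have htr : LinearMap.trace F V c = (Module.finrank F T : F) := by
      have : ∀ i, LinearMap.trace F V (toEnd F S V (e i) * toEnd F S V (f i)) = 1 := fun i => by
        have := LinearMap.BilinForm.apply_dualBasis_right hnd hsym e i i
        rwa [if_pos rfl] at this
      simp [c, map_sum, this]
    rw [htr, Nat.cast_ne_zero]
    intro h0
    have hTz : ∀ t ∈ T, t = 0 := fun t ht => by
      have := Module.finrank_zero_iff.1 h0
      exact congrArg Subtype.val (Subsingleton.elim (⟨t, ht⟩ : T) 0)
    obtain ⟨x, v, hxv⟩ := hV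
    obtain ⟨k, hk, t, ht, rfl⟩ := hdecomp x
    apply hxv
    rw [hTz t ht, add_zero, hKv k hk]

/-- **Casimir operator** for a nontrivial module on which the radical acts trivially. -/
theorem LieModule.exists_casimir_of_radical_trivial {F L V : Type*} [Field F] [CharZero F]
    [LieRing L] [LieAlgebra F L] [FiniteDimensional F L] [AddCommGroup V]
    [Module F V] [FiniteDimensional F V] [LieRingModule L V] [LieModule F L V]
    (hR : ∀ x ∈ radical F L, ∀ v : V, ⁅x, v⁆ = 0)
    (hV : ∃ (x : L) (v : V), ⁅x, v⁆ ≠ 0) :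
    ∃ c : Module.End F V, (∀ (x : L) (v : V), c ⁅x, v⁆ = ⁅x, c v⁆) ∧
      (∀ v, c v ∈ Submodule.span F {w : V | ∃ (x : L) (v : V), ⁅x, v⁆ = w}) ∧
      (∀ v : V, (∀ x : L, ⁅x, v⁆ = 0) → c v = 0) ∧ LinearMap.trace F V c ≠ 0 := by
  have hle : (radical F L).toSubmodule ≤ LinearMap.ker (toEnd F L V : L →ₗ[F] Module.End F V) :=
    fun x hx => LinearMap.ext fun v => hR x hx v
  let φ : (L ⧸ radical F L) →ₗ⁅F⁆ Module.End F V :=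
    { Submodule.liftQ (radical F L).toSubmodule (toEnd F L V : L →ₗ[F] Module.End F V) hle with
      map_lie' := by
        intro x y
        obtain ⟨x, rfl⟩ := LieSubmodule.Quotient.surjective_mk' _ x
        obtain ⟨y, rfl⟩ := LieSubmodule.Quotient.surjective_mk' _ y
        exact (toEnd F L V).map_lie x y }
  let _ := LieRingModule.compLieHom V φ
  have := LieModule.compLieHom (R := F) V φ
  have : IsKilling F (L ⧸ radical F L) := inferInstance
  have hact : ∀ (x : L) (v : V), ⁅(LieSubmodule.Quotient.mk x : L ⧸ radical F L), v⁆ = ⁅x, v⁆ :=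
    fun x v => rfl
  obtain ⟨x, v, hxv⟩ := hV
  obtain ⟨c, h1, h2, h3, h4⟩ := LieModule.exists_casimir (F := F) (S := L ⧸ radical F L) (V := V)
    ⟨LieSubmodule.Quotient.mk x, v, hxv⟩
  refine ⟨c, fun x v => h1 (LieSubmodule.Quotient.mk x) v, fun v => ?_, fun v hv => ?_, h4⟩
  · refine Submodule.span_mono ?_ (h2 v)
    rintro w ⟨s, v, rfl⟩
    obtain ⟨x, rfl⟩ := LieSubmodule.Quotient.surjective_mk' _ s
    exact ⟨x, v, rfl⟩
  · refine h3 v fun s => ?_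
    obtain ⟨x, rfl⟩ := LieSubmodule.Quotient.surjective_mk' _ s
    exact hv x

/-- A finite-dimensional module on which the radical acts trivially is the direct sum of its
invariants and of `L · V`. -/
theorem LieModule.isCompl_maxTrivSubmodule_lie_top {F L V : Type*} [Field F] [CharZero F]
    [LieRing L] [LieAlgebra F L] [FiniteDimensional F L] [AddCommGroup V]
    [Module F V] [FiniteDimensional F V] [LieRingModule L V] [LieModule F L V]
    (hR : ∀ x ∈ radical F L, ∀ v : V, ⁅x, v⁆ = 0) :
    IsCompl (maxTrivSubmodule F L V) ⁅(⊤ : LieIdeal F L), (⊤ : LieSubmodule F L V)⁆ := by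
  induction hn : Module.finrank F V using Nat.strong_induction_on generalizing V with
  | _ n ih =>
  by_cases hV : ∃ (x : L) (v : V), ⁅x, v⁆ ≠ 0
  swap
  · push Not at hV
    have h1 : maxTrivSubmodule F L V = ⊤ := by
      rw [eq_top_iff]; exact fun v _ => (mem_maxTrivSubmodule F L V v).2 fun x => hV x v
    have h2 : ⁅(⊤ : LieIdeal F L), (⊤ : LieSubmodule F L V)⁆ = ⊥ := by
      rw [eq_bot_iff, LieSubmodule.lieIdeal_oper_eq_span, LieSubmodule.lieSpan_le]
      rintro _ ⟨x, v, rfl⟩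
      exact hV x v
    rw [h1, h2]
    exact isCompl_top_bot
  obtain ⟨c, hc1, hc2, hc3, hc4⟩ := exists_casimir_of_radical_trivial hR hV
  obtain ⟨m, hm⟩ := (LinearMap.eventually_isCompl_ker_pow_range_pow c).exists_forall_of_atTop
  have hcomp := hm (m + 1) (Nat.le_succ m)
  have hcm : ∀ (k : ℕ) (x : L) (v : V), (c ^ k) ⁅x, v⁆ = ⁅x, (c ^ k) v⁆ := by
    intro k x
    induction k with
    | zero => intro v; rfl
    | succ k ih => intro v; rw [pow_succ, Module.End.mul_apply, Module.End.mul_apply, hc1, ih]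
  let V0 : LieSubmodule F L V :=
    { LinearMap.ker (c ^ (m + 1)) with
      lie_mem := fun {x v} hv => by
        change (c ^ (m + 1)) ⁅x, v⁆ = 0
        rw [hcm, show (c ^ (m + 1)) v = 0 from hv, lie_zero] }
  let V1 : LieSubmodule F L V :=
    { LinearMap.range (c ^ (m + 1)) with
      lie_mem := fun {x v} hv => by
        obtain ⟨w, rfl⟩ := hv
        exact ⟨⁅x, w⁆, hcm _ x w⟩ }
  have hV0 : Module.finrank F V0 < n := by
    rw [← hn]
    refine Submodule.finrank_lt (s := V0.toSubmodule) fun h => hc4 ?_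
    have : c ^ (m + 1) = 0 := LinearMap.ker_eq_top.1 h
    exact (LinearMap.isNilpotent_trace_of_isNilpotent ⟨m + 1, this⟩).eq_zero
  have ih0 := ih _ hV0 (V := V0) (fun x hx v => Subtype.ext (hR x hx v)) rfl
  have hsup : ∀ v : V, ∃ a ∈ V0, ∃ b ∈ V1, a + b = v := fun v =>
    Submodule.mem_sup.1 (by rw [hcomp.sup_eq_top]; trivial)
  have hdisj : ∀ v : V, v ∈ V0 → v ∈ V1 → v = 0 := fun v h0 h1 => by
    have : v ∈ LinearMap.ker (c ^ (m + 1)) ⊓ LinearMap.range (c ^ (m + 1)) := ⟨h0, h1⟩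
    rwa [hcomp.inf_eq_bot] at this
  have hmap : ∀ w : V0, w ∈ ⁅(⊤ : LieIdeal F L), (⊤ : LieSubmodule F L V0)⁆ ↔
      (w : V) ∈ ⁅(⊤ : LieIdeal F L), V0⁆ := fun w => by
    have : ⁅(⊤ : LieIdeal F L), V0⁆ = LieSubmodule.map V0.incl ⁅(⊤ : LieIdeal F L), ⊤⁆ := by
      rw [LieSubmodule.map_bracket_eq]
      simp
    rw [this, LieSubmodule.mem_map]
    constructor
    · exact fun h => ⟨w, h, rfl⟩
    · rintro ⟨w', h, h'⟩
      rwa [← Subtype.ext h']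
  refine ⟨?_, ?_⟩
  · rw [disjoint_iff, eq_bot_iff]
    rintro x ⟨hx1, hx2⟩
    have hx1' := (mem_maxTrivSubmodule F L V x).1 hx1
    have hx0 : x ∈ V0 := by
      change (c ^ (m + 1)) x = 0
      rw [pow_succ, Module.End.mul_apply, hc3 x hx1', map_zero]
    have htop : (⊤ : LieSubmodule F L V) = V0 ⊔ V1 := by
      rw [eq_comm, eq_top_iff]
      exact fun v _ => (LieSubmodule.mem_sup _ _ _).2 (hsup v)
    rw [htop, LieSubmodule.lie_sup] at hx2
    obtain ⟨a, ha, b, hb, hab⟩ := (LieSubmodule.mem_sup _ _ _).1 hx2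
    have ha' := LieSubmodule.lie_le_right V0 _ ha
    have hb' := LieSubmodule.lie_le_right V1 _ hb
    have hb0 : b = 0 := hdisj b (by
      rw [← add_sub_cancel_left a b, hab]; exact sub_mem hx0 ha') hb'
    rw [hb0, add_zero] at hab
    subst hab
    have h1 := (hmap ⟨a, ha'⟩).2 ha
    have h2 : (⟨a, ha'⟩ : V0) ∈ maxTrivSubmodule F L V0 :=
      (mem_maxTrivSubmodule F L V0 _).2 fun x => Subtype.ext (hx1' x)
    have h3 : (⟨a, ha'⟩ : V0) ∈ (⊥ : LieSubmodule F L V0) := by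
      rw [← ih0.inf_eq_bot]; exact ⟨h2, h1⟩
    exact congrArg Subtype.val ((LieSubmodule.mem_bot _).1 h3)
  · rw [codisjoint_iff, eq_top_iff]
    intro v _
    obtain ⟨a, ha, b, hb, rfl⟩ := hsup v
    have hb' : b ∈ ⁅(⊤ : LieIdeal F L), (⊤ : LieSubmodule F L V)⁆ := by
      obtain ⟨w, rfl⟩ := hb
      rw [pow_succ', Module.End.mul_apply, ← LieSubmodule.mem_toSubmodule,
        LieSubmodule.lieIdeal_oper_eq_linear_span]
      refine Submodule.span_mono ?_ (hc2 _)
      rintro _ ⟨x, v, rfl⟩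
      exact ⟨⟨x, trivial⟩, ⟨v, trivial⟩, rfl⟩
    refine add_mem ?_ ((LieSubmodule.mem_sup _ _ _).2 ⟨0, zero_mem _, b, hb', zero_add b⟩)
    have : (⟨a, ha⟩ : V0) ∈ maxTrivSubmodule F L V0 ⊔ ⁅(⊤ : LieIdeal F L), ⊤⁆ := by
      rw [ih0.sup_eq_top]; trivial
    obtain ⟨p, hp, q, hq, hpq⟩ := (LieSubmodule.mem_sup _ _ _).1 this
    refine (LieSubmodule.mem_sup _ _ _).2 ⟨p, ?_, q, ?_, congrArg Subtype.val hpq⟩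
    · exact (mem_maxTrivSubmodule F L V _).2 fun x =>
        congrArg Subtype.val ((mem_maxTrivSubmodule F L V0 _).1 hp x)
    · exact LieSubmodule.mono_lie_right _ le_top ((hmap q).1 hq)

/-- If `n ∈ ⁅L, Rad L⁆`, then `n` composed with any element of `L` acts nilpotently on every
finite-dimensional module. -/
theorem LieModule.isNilpotent_toEnd_lie_radical_mul {F L V : Type*} [Field F] [IsAlgClosed F]
    [CharZero F] [LieRing L] [LieAlgebra F L] [FiniteDimensional F L] [AddCommGroup V]
    [Module F V] [FiniteDimensional F V] [LieRingModule L V] [LieModule F L V]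
    (y z : L) {x : L} (hx : x ∈ radical F L) :
    _root_.IsNilpotent (toEnd F L V ⁅y, x⁆ * toEnd F L V z) := by
  induction hn : Module.finrank F V using Nat.strong_induction_on generalizing V with
  | _ n ih =>
  by_cases hV : ∃ N : LieSubmodule F L V, N ≠ ⊥ ∧ N ≠ ⊤
  · obtain ⟨N, hN0, hN1⟩ := hV
    have hN1' : N.toSubmodule ≠ ⊤ := by simpa using hN1
    have hN0' : N.toSubmodule ≠ ⊥ := by simpa using hN0
    have h1 : Module.finrank F N < n := by
      rw [← hn]; exact Submodule.finrank_lt (s := N.toSubmodule) hN1'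
    have h2 : Module.finrank F (V ⧸ N) < n := by
      have h3 : Module.finrank F (V ⧸ N) + Module.finrank F N = Module.finrank F V :=
        Submodule.finrank_quotient_add_finrank N.toSubmodule
      have h4 : 0 < Module.finrank F N := by
        have := Submodule.one_le_finrank_iff (S := N.toSubmodule) |>.2 hN0'
        exact this
      omega
    obtain ⟨a, ha⟩ := ih _ h1 (V := N) rfl
    obtain ⟨b, hb⟩ := ih _ h2 (V := V ⧸ N) rfl
    refine ⟨a + b, LinearMap.ext fun v => ?_⟩
    have hq : ∀ (k : ℕ) (v : V), (LieSubmodule.Quotient.mk (((toEnd F L V ⁅y, x⁆ * toEnd F L V z) ^ k) v) :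
        V ⧸ N) = ((toEnd F L (V ⧸ N) ⁅y, x⁆ * toEnd F L (V ⧸ N) z) ^ k)
          (LieSubmodule.Quotient.mk v) := by
      intro k
      induction k with
      | zero => intro v; rfl
      | succ k ih => intro v; rw [pow_succ, Module.End.mul_apply, ih, pow_succ,
          Module.End.mul_apply]; rfl
    have hs : ∀ (k : ℕ) (v : N), (((toEnd F L V ⁅y, x⁆ * toEnd F L V z) ^ k) (v : V)) =
        (((toEnd F L N ⁅y, x⁆ * toEnd F L N z) ^ k) v : N) := by
      intro k
      induction k with
      | zero => intro v; rfl
      | succ k ih => intro v; rw [pow_succ, pow_succ]; exact ih ⁅⁅y, x⁆, ⁅z, v⁆⁆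
    have hb' : ((toEnd F L V ⁅y, x⁆ * toEnd F L V z) ^ b) v ∈ N := by
      rw [← LieSubmodule.Quotient.mk_eq_zero', hq, hb, LinearMap.zero_apply]
    rw [pow_add, Module.End.mul_apply, hs a ⟨_, hb'⟩, ha]
    rfl
  · push Not at hV
    rcases subsingleton_or_nontrivial V with hs | hs
    · exact ⟨1, LinearMap.ext fun v => Subsingleton.elim _ _⟩
    obtain ⟨χ, hχ⟩ : ∃ χ : Module.Dual F (radical F L), Nontrivial (weightSpace V χ) :=
      exists_nontrivial_weightSpace_of_isSolvable F (radical F L) V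
    let N : LieSubmodule F L V := weightSpaceOfIsLieTower F V χ
    replace hχ : Nontrivial N := hχ
    replace hχ : N = ⊤ := hV N ((LieSubmodule.nontrivial_iff_ne_bot F L V).1 hχ)
    have hact : ∀ (x : L) (hx : x ∈ radical F L) (m : V), ⁅x, m⁆ = χ ⟨x, hx⟩ • m := by
      intro x hx m
      have hm : ∀ (y : L) (hy : y ∈ radical F L), ⁅y, m⁆ = χ ⟨y, hy⟩ • m := by
        simpa [N, weightSpaceOfIsLieTower, mem_weightSpace] using
          (hχ ▸ LieSubmodule.mem_top _ : m ∈ N)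
      exact hm x hx
    refine ⟨1, LinearMap.ext fun v => ?_⟩
    have : ∀ w : V, ⁅⁅y, x⁆, w⁆ = 0 := fun w => by
      rw [lie_lie, hact x hx, hact x hx, lie_smul, sub_self]
    simpa using this ⁅z, v⁆

/-- The radical is the orthogonal of the derived algebra with respect to the Killing form. -/
theorem LieAlgebra.mem_radical_iff_killingForm {F L : Type*} [Field F] [IsAlgClosed F]
    [CharZero F] [LieRing L] [LieAlgebra F L] [FiniteDimensional F L] {x : L} :
    x ∈ radical F L ↔ ∀ y z : L, killingForm F L x ⁅y, z⁆ = 0 := by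
  constructor
  · intro hx y z
    have : killingForm F L x ⁅y, z⁆ = - killingForm F L ⁅y, x⁆ z := by
      rw [LieModule.traceForm_apply_lie_apply', neg_neg]
    rw [this, killingForm_apply_apply]
    have := LinearMap.isNilpotent_trace_of_isNilpotent
      (LieModule.isNilpotent_toEnd_lie_radical_mul (F := F) (V := L) y z hx)
    rw [neg_eq_zero]
    exact this.eq_zero
  · intro hx
    let I : LieIdeal F L := LieIdeal.killingCompl F L ⁅(⊤ : LieIdeal F L), (⊤ : LieIdeal F L)⁆
    have hI : ∀ x, (∀ y z : L, killingForm F L x ⁅y, z⁆ = 0) → x ∈ I := by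
      intro x hx
      rw [LieIdeal.mem_killingCompl]
      intro w hw
      rw [← LieSubmodule.mem_toSubmodule, LieSubmodule.lieIdeal_oper_eq_linear_span] at hw
      induction hw using Submodule.span_induction with
      | mem w hw =>
        obtain ⟨⟨y, _⟩, ⟨z, _⟩, rfl⟩ := hw
        rw [LieModule.traceForm_comm]
        exact hx y z
      | zero => simp
      | add a b _ _ ha hb => simp [ha, hb]
      | smul t a _ ha => simp [ha]
    have : IsSolvable I := by
      refine LieIdeal.isSolvable_of_killingForm_apply_lie_eq_zero I fun a ha b hb => ?_
      rw [LieModule.traceForm_comm]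
      exact (LieIdeal.mem_killingCompl F L _).1 ha b (LieSubmodule.mono_lie le_top le_top hb)
    exact (LieIdeal.solvable_iff_le_radical F L I).1 this (hI x hx)

/-- A family of linear maps which are the projections onto the homogeneous components of a
`G`-grading of the Lie algebra `L`. -/
structure IsGradingProj {G F L : Type*} [Group G] [Fintype G] [Field F] [LieRing L]
    [LieAlgebra F L] (p : G → L →ₗ[F] L) : Prop where
  self : ∀ g x, p g (p g x) = p g x
  ne : ∀ g h x, g ≠ h → p g (p h x) = 0
  sum : ∀ x, ∑ g, p g x = x
  lie : ∀ g h x y, p (g * h) ⁅p g x, p h y⁆ = ⁅p g x, p h y⁆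

section

variable {G F L : Type*} [Group G] [Fintype G] [Field F] [LieRing L] [LieAlgebra F L]

theorem IsLieGrading.exists_isGradingProj {𝒜 : G → Submodule F L} (h : IsLieGrading 𝒜) :
    ∃ p : G → L →ₗ[F] L, IsGradingProj p ∧ ∀ g x, x ∈ 𝒜 g ↔ p g x = x := by
  classical
  obtain ⟨h1, h2⟩ := h
  have h1 : DirectSum.IsInternal 𝒜 := by convert h1
  let _ := h1.chooseDecomposition
  let p : G → L →ₗ[F] L := fun g => (𝒜 g).subtype ∘ₗ DirectSum.component F G (fun g => 𝒜 g) g ∘ₗ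
    (DirectSum.decomposeLinearEquiv 𝒜 : L →ₗ[F] DirectSum G fun g => 𝒜 g)
  have hp : ∀ g x, p g x = (DirectSum.decompose 𝒜 x g : L) := fun g x => rfl
  have hmem : ∀ g x, p g x ∈ 𝒜 g := fun g x => (DirectSum.decompose 𝒜 x g).2
  have hself : ∀ g, ∀ x ∈ 𝒜 g, p g x = x := fun g x hx => by
    rw [hp, DirectSum.decompose_of_mem_same _ hx]
  refine ⟨p, ⟨fun g x => hself g _ (hmem g x), fun g h x hgh => ?_, fun x => ?_, fun g h x y => ?_⟩,
    fun g x => ⟨hself g x, fun h => h ▸ hmem g x⟩⟩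
  · rw [hp, DirectSum.decompose_of_mem_ne _ (hmem h x) hgh.symm]
  · conv_rhs => rw [← DirectSum.sum_support_decompose 𝒜 x]
    refine (Finset.sum_subset (Finset.subset_univ _) fun g _ hg => ?_).symm
    rw [DFinsupp.notMem_support_iff] at hg
    exact congrArg Subtype.val hg
  · exact hself _ _ (h2 g h _ (hmem g x) _ (hmem h y))

theorem isGradedSubspace_iff {𝒜 : G → Submodule F L} {p : G → L →ₗ[F] L} (hp : IsGradingProj p)
    (h𝒜 : ∀ g x, x ∈ 𝒜 g ↔ p g x = x) {V : Submodule F L} :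
    IsGradedSubspace 𝒜 V ↔ ∀ g, ∀ x ∈ V, p g x ∈ V := by
  constructor
  · intro h g x hx
    have hle : ⨆ h : G, 𝒜 h ⊓ V ≤ V.comap (p g) := by
      refine iSup_le fun h y hy => ?_
      rw [Submodule.mem_comap]
      by_cases hgh : g = h
      · subst hgh
        rw [(h𝒜 _ _).1 hy.1]
        exact hy.2
      · rw [← (h𝒜 _ _).1 hy.1, hp.ne _ _ _ hgh]
        exact zero_mem _
    rw [IsGradedSubspace] at h
    rw [h] at hx
    exact hle hx
  · intro h
    refine le_antisymm (fun x hx => ?_) (iSup_le fun g => inf_le_right)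
    rw [← hp.sum x]
    refine Submodule.sum_mem _ fun g _ => ?_
    exact (le_iSup (fun g => 𝒜 g ⊓ V) g) ⟨(h𝒜 _ _).2 (hp.self g x), h g x hx⟩

theorem IsGradingProj.isLieGrading {𝒜 : G → Submodule F L} {p : G → L →ₗ[F] L}
    (hp : IsGradingProj p) (h𝒜 : ∀ g x, x ∈ 𝒜 g ↔ p g x = x) : IsLieGrading 𝒜 := by
  classical
  refine ⟨?_, fun g h x hx y hy => ?_⟩
  · rw [DirectSum.isInternal_submodule_iff_iSupIndep_and_iSup_eq_top]
    constructor
    · intro g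
      rw [Submodule.disjoint_def]
      intro x hx hx'
      rw [← (h𝒜 g x).1 hx]
      have : ⨆ h, ⨆ (_ : h ≠ g), 𝒜 h ≤ LinearMap.ker (p g) := by
        refine iSup₂_le fun h hh y hy => ?_
        rw [LinearMap.mem_ker, ← (h𝒜 _ _).1 hy, hp.ne _ _ _ hh.symm]
      exact this hx'
    · have := (isGradedSubspace_iff hp h𝒜 (V := ⊤)).2 fun g x _ => trivial
      rw [IsGradedSubspace] at this
      rw [this]
      simp
  · rw [h𝒜, ← (h𝒜 _ _).1 hx, ← (h𝒜 _ _).1 hy, hp.lie]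

theorem IsGradingProj.restrict {p : G → L →ₗ[F] L} (hp : IsGradingProj p) (B : LieSubalgebra F L)
    (hB : ∀ g, ∀ x ∈ B, p g x ∈ B) :
    IsGradingProj (L := B) fun g => (p g).restrict (p := B.toSubmodule) (q := B.toSubmodule)
      (hB g) where
  self g x := Subtype.ext (hp.self g x)
  ne g h x hgh := Subtype.ext (hp.ne g h x hgh)
  sum x := Subtype.ext <| by
    refine Eq.trans ?_ (hp.sum x)
    exact map_sum B.toSubmodule.subtype _ _
  lie g h x y := Subtype.ext (hp.lie g h x y)

theorem IsGradingProj.killingForm_eq_zero [FiniteDimensional F L] {p : G → L →ₗ[F] L}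
    (hp : IsGradingProj p) {g h : G} (hgh : g * h ≠ 1) (x y : L) :
    killingForm F L (p g x) (p h y) = 0 := by
  classical
  have hI := (hp.isLieGrading (𝒜 := fun g => LinearMap.eqLocus (p g) LinearMap.id)
    fun g x => Iff.rfl).1
  have hI : DirectSum.IsInternal (fun g => LinearMap.eqLocus (p g) LinearMap.id) := by convert hI
  rw [killingForm_apply_apply]
  refine LinearMap.trace_eq_zero_of_mapsTo_ne hI (fun k => g * (h * k)) (fun k hk => hgh ?_) ?_
  · rwa [← mul_assoc, mul_eq_right] at hk
  · intro k z hz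
    have hz : p k z = z := hz
    change p (g * (h * k)) ⁅p g x, ⁅p h y, z⁆⁆ = ⁅p g x, ⁅p h y, z⁆⁆
    rw [← hz, ← hp.lie h k, hp.lie g (h * k)]

/-- Orthogonality of homogeneous components for the Killing form. -/
theorem IsGradingProj.killingForm_proj [FiniteDimensional F L] {p : G → L →ₗ[F] L}
    (hp : IsGradingProj p) (g : G) (x y : L) :
    killingForm F L (p g x) y = killingForm F L x (p g⁻¹ y) := by
  have h1 : killingForm F L (p g x) y = killingForm F L (p g x) (p g⁻¹ y) := by
    conv_lhs => rw [← hp.sum y, map_sum]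
    refine Finset.sum_eq_single _ (fun h _ hh => hp.killingForm_eq_zero (fun h1 => hh ?_) _ _)
      (by simp)
    exact (inv_eq_of_mul_eq_one_right h1).symm
  have h2 : killingForm F L x (p g⁻¹ y) = killingForm F L (p g x) (p g⁻¹ y) := by
    conv_lhs => rw [← hp.sum x, map_sum, LinearMap.sum_apply]
    refine Finset.sum_eq_single _ (fun h _ hh => hp.killingForm_eq_zero (fun h1 => hh ?_) _ _)
      (by simp)
    exact mul_inv_eq_one.1 h1
  rw [h1, h2]

/-- The components of a bracket. -/
theorem IsGradingProj.proj_lie {p : G → L →ₗ[F] L} (hp : IsGradingProj p) (g : G) (x y : L) :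
    p g ⁅x, y⁆ = ∑ h, ⁅p h x, p (h⁻¹ * g) y⁆ := by
  conv_lhs => rw [← hp.sum x, sum_lie, map_sum]
  refine Finset.sum_congr rfl fun h _ => ?_
  conv_lhs => rw [← hp.sum y, lie_sum, map_sum]
  rw [Finset.sum_eq_single (h⁻¹ * g)]
  · nth_rewrite 1 [show g = h * (h⁻¹ * g) by group]
    exact hp.lie _ _ _ _
  · intro k _ hk
    rw [← hp.lie, hp.ne]
    rintro rfl
    simp at hk
  · simp

theorem IsGradingProj.proj_mem_radical [IsAlgClosed F] [CharZero F] [FiniteDimensional F L]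
    {p : G → L →ₗ[F] L} (hp : IsGradingProj p) (g : G) {x : L} (hx : x ∈ radical F L) :
    p g x ∈ radical F L := by
  rw [mem_radical_iff_killingForm] at hx ⊢
  intro y z
  rw [hp.killingForm_proj, hp.proj_lie, map_sum]
  exact Finset.sum_eq_zero fun h _ => hx _ _

end

section

variable {F L V : Type*} [Field F] [LieRing L] [LieAlgebra F L] [AddCommGroup V] [Module F V]
  [LieRingModule L V] [LieModule F L V]

theorem LieSubmodule.coe_mem_lie_of_mem_lie_top {C : LieSubmodule F L V} {v : C}
    (hv : v ∈ ⁅(⊤ : LieIdeal F L), (⊤ : LieSubmodule F L C)⁆) :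
    (v : V) ∈ ⁅(⊤ : LieIdeal F L), C⁆ := by
  have : ⁅(⊤ : LieIdeal F L), C⁆ = LieSubmodule.map C.incl ⁅(⊤ : LieIdeal F L), ⊤⁆ := by
    rw [LieSubmodule.map_bracket_eq]
    simp
  rw [this]
  exact LieSubmodule.mem_map_of_mem hv

theorem LieSubmodule.mem_lie_top_of_coe_mem_lie {C : LieSubmodule F L V} {v : C}
    (hv : (v : V) ∈ ⁅(⊤ : LieIdeal F L), C⁆) :
    v ∈ ⁅(⊤ : LieIdeal F L), (⊤ : LieSubmodule F L C)⁆ := by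
  have : ⁅(⊤ : LieIdeal F L), C⁆ = LieSubmodule.map C.incl ⁅(⊤ : LieIdeal F L), ⊤⁆ := by
    rw [LieSubmodule.map_bracket_eq]
    simp
  rw [this, LieSubmodule.mem_map] at hv
  obtain ⟨w, hw, h⟩ := hv
  rwa [← Subtype.ext h]

theorem LieSubmodule.mk_mem_lie_top_iff {N : LieSubmodule F L V} {u : V ⧸ N} :
    u ∈ ⁅(⊤ : LieIdeal F L), (⊤ : LieSubmodule F L (V ⧸ N))⁆ ↔
      ∃ v ∈ ⁅(⊤ : LieIdeal F L), (⊤ : LieSubmodule F L V)⁆, LieSubmodule.Quotient.mk v = u := by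
  have : ⁅(⊤ : LieIdeal F L), (⊤ : LieSubmodule F L (V ⧸ N))⁆ =
      LieSubmodule.map (LieSubmodule.Quotient.mk' N) ⁅(⊤ : LieIdeal F L), ⊤⁆ := by
    rw [LieSubmodule.map_bracket_eq, LieModuleHom.map_top, LieSubmodule.Quotient.range_mk']
  rw [this, LieSubmodule.mem_map]
  rfl

variable [CharZero F] [FiniteDimensional F L] [FiniteDimensional F V]

/-- If the radical maps `C` into `N`, then every element of `C` can be corrected by an element of
`L · C` to become invariant modulo `N`. -/
theorem LieModule.exists_sub_mem_lie_and_lie_mem {C N : LieSubmodule F L V}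
    (hCN : ∀ x ∈ radical F L, ∀ v ∈ C, ⁅x, v⁆ ∈ N) {v : V} (hv : v ∈ C) :
    ∃ w ∈ C, v - w ∈ ⁅(⊤ : LieIdeal F L), C⁆ ∧ ∀ x : L, ⁅x, w⁆ ∈ N := by
  have hT := isCompl_maxTrivSubmodule_lie_top (F := F) (L := L) (V := C ⧸ N.comap C.incl) (by
    intro x hx u
    obtain ⟨u, rfl⟩ := LieSubmodule.Quotient.surjective_mk' _ u
    exact LieSubmodule.Quotient.mk_eq_zero'.2 (hCN x hx u u.2))
  have h : (LieSubmodule.Quotient.mk ⟨v, hv⟩ : C ⧸ N.comap C.incl) ∈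
      maxTrivSubmodule F L (C ⧸ N.comap C.incl) ⊔ ⁅(⊤ : LieIdeal F L), ⊤⁆ := by
    rw [hT.sup_eq_top]; trivial
  obtain ⟨a, ha, b, hb, hab⟩ := (LieSubmodule.mem_sup _ _ _).1 h
  obtain ⟨b, hb', rfl⟩ := LieSubmodule.mk_mem_lie_top_iff.1 hb
  refine ⟨v - b, sub_mem hv b.2, ?_, fun x => ?_⟩
  · rw [sub_sub_cancel]
    exact LieSubmodule.coe_mem_lie_of_mem_lie_top hb'
  · have h1 := (mem_maxTrivSubmodule F L _ a).1 ha x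
    rw [eq_sub_of_add_eq hab] at h1
    have h2 : LieSubmodule.Quotient.mk' (N.comap C.incl) ⁅x, ⟨v, hv⟩ - b⁆ = 0 := by
      rw [LieModuleHom.map_lie, map_sub]
      exact h1
    exact (LieSubmodule.Quotient.mk_eq_zero' (N := N.comap C.incl)).1 h2

/-- If the radical maps `C` into `N`, then an element of `L · C` which is invariant modulo `N`
lies in `N`. -/
theorem LieModule.mem_of_lie_mem_of_mem_lie {C N : LieSubmodule F L V}
    (hCN : ∀ x ∈ radical F L, ∀ v ∈ C, ⁅x, v⁆ ∈ N) {v : V} (hv : v ∈ ⁅(⊤ : LieIdeal F L), C⁆)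
    (hvN : ∀ x : L, ⁅x, v⁆ ∈ N) : v ∈ N := by
  have hT := isCompl_maxTrivSubmodule_lie_top (F := F) (L := L) (V := C ⧸ N.comap C.incl) (by
    intro x hx u
    obtain ⟨u, rfl⟩ := LieSubmodule.Quotient.surjective_mk' _ u
    exact LieSubmodule.Quotient.mk_eq_zero'.2 (hCN x hx u u.2))
  have hvC : v ∈ C := LieSubmodule.lie_le_right C _ hv
  have h1 : (LieSubmodule.Quotient.mk ⟨v, hvC⟩ : C ⧸ N.comap C.incl) ∈
      maxTrivSubmodule F L (C ⧸ N.comap C.incl) :=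
    (mem_maxTrivSubmodule F L _ _).2 fun x => LieSubmodule.Quotient.mk_eq_zero'.2 (hvN x)
  have h2 : (LieSubmodule.Quotient.mk ⟨v, hvC⟩ : C ⧸ N.comap C.incl) ∈
      ⁅(⊤ : LieIdeal F L), (⊤ : LieSubmodule F L (C ⧸ N.comap C.incl))⁆ :=
    LieSubmodule.mk_mem_lie_top_iff.2 ⟨_, LieSubmodule.mem_lie_top_of_coe_mem_lie hv, rfl⟩
  have h3 : (LieSubmodule.Quotient.mk ⟨v, hvC⟩ : C ⧸ N.comap C.incl) ∈
      (⊥ : LieSubmodule F L (C ⧸ N.comap C.incl)) := by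
    rw [← hT.inf_eq_bot]; exact ⟨h1, h2⟩
  exact (LieSubmodule.Quotient.mk_eq_zero' (N := N.comap C.incl)).1 ((LieSubmodule.mem_bot _).1 h3)

end

section

variable {F L : Type*} [Field F] [CharZero F] [LieRing L] [LieAlgebra F L]
  [FiniteDimensional F L]

/-- If `⁅L, Rad L⁆ ≠ Rad L`, then modulo `⁅L, Rad L⁆` the radical is a direct factor. -/
theorem LieAlgebra.exists_derivation_of_lie_top_radical :
    ∃ e : L →ₗ[F] L, (∀ x, e x ∈ radical F L) ∧
      (∀ r ∈ radical F L, e r - r ∈ ⁅(⊤ : LieIdeal F L), radical F L⁆) ∧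
      ∀ x y, e ⁅x, y⁆ - (⁅x, e y⁆ + ⁅e x, y⁆) ∈ ⁅(⊤ : LieIdeal F L), radical F L⁆ := by
  set R := radical F L with hR
  set R' : LieIdeal F L := ⁅(⊤ : LieIdeal F L), R⁆ with hR'
  have hR'R : R' ≤ R := LieSubmodule.lie_le_right _ _
  have hRR' : ∀ r ∈ R, ∀ x : L, ⁅x, r⁆ ∈ R' := fun r hr x =>
    LieSubmodule.lie_mem_lie (LieSubmodule.mem_top x) hr
  have hRR'' : ∀ r ∈ R, ∀ x : L, ⁅r, x⁆ ∈ R' := fun r hr x => by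
    rw [← lie_skew]; exact neg_mem (hRR' r hr x)
  set D0 : LieIdeal F L := ⁅(⊤ : LieIdeal F L), (⊤ : LieIdeal F L)⁆ with hD0
  obtain ⟨Q, hQ⟩ := Submodule.exists_isCompl R'.toSubmodule
  have hdisj : Disjoint (R.toSubmodule ⊓ Q) D0.toSubmodule := by
    rw [Submodule.disjoint_def]
    rintro x ⟨hxR, hxQ⟩ hxD
    have hxR' : x ∈ R' := LieModule.mem_of_lie_mem_of_mem_lie (C := ⊤)
      (fun r hr y _ => hRR'' r hr y) hxD (hRR' x hxR)
    exact (Submodule.disjoint_def.1 hQ.disjoint) x hxR' hxQ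
  obtain ⟨D, hD, hCD⟩ : ∃ D, D0.toSubmodule ≤ D ∧ IsCompl (R.toSubmodule ⊓ Q) D := by
    obtain ⟨D, hD, hCD⟩ := hdisj.symm.exists_isCompl
    exact ⟨D, hD, hCD.symm⟩
  let e : L →ₗ[F] L := (R.toSubmodule ⊓ Q).subtype ∘ₗ
    Submodule.projectionOnto (R.toSubmodule ⊓ Q) D hCD
  have heD : ∀ x ∈ D, e x = 0 := fun x hx => by
    exact congrArg Subtype.val ((Submodule.projectionOnto_apply_eq_zero_iff hCD).2 hx)
  have heC : ∀ x ∈ R.toSubmodule ⊓ Q, e x = x := fun x hx => by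
    have := Submodule.projectionOnto_apply_left hCD ⟨x, hx⟩
    exact congrArg Subtype.val this
  have heR : ∀ x, e x ∈ R := fun x =>
    (Submodule.projectionOnto (R.toSubmodule ⊓ Q) D hCD x).2.1
  refine ⟨e, heR, fun r hr => ?_, fun x y => ?_⟩
  · have : r ∈ R'.toSubmodule ⊔ Q := by rw [hQ.sup_eq_top]; trivial
    obtain ⟨a, ha, b, hb, rfl⟩ := Submodule.mem_sup.1 this
    have hbR : b ∈ R := by
      have := sub_mem hr (hR'R ha)
      rwa [add_sub_cancel_left] at this
    rw [map_add, heC b ⟨hbR, hb⟩, heD a (hD (LieSubmodule.mono_lie_right _ le_top ha)), zero_add]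
    rw [sub_add_cancel_right]
    exact neg_mem ha
  · rw [heD _ (hD (LieSubmodule.lie_mem_lie (LieSubmodule.mem_top x) (LieSubmodule.mem_top y)))]
    exact sub_mem (zero_mem _) (add_mem (hRR' _ (heR y) x) (hRR'' _ (heR x) y))

end

section

variable {F L : Type*} [Field F] [CharZero F] [LieRing L] [LieAlgebra F L]
  [FiniteDimensional F L]

/-- If `⁅L, Rad L⁆ = Rad L`, then the projection of the radical onto its abelianization extends
to a derivation of `L`. -/
theorem LieAlgebra.exists_derivation_of_lie_radical_radical
    (hLR : ⁅(⊤ : LieIdeal F L), radical F L⁆ = radical F L) :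
    ∃ e : L →ₗ[F] L, (∀ x, e x ∈ radical F L) ∧
      (∀ r ∈ radical F L, e r - r ∈ ⁅radical F L, radical F L⁆) ∧
      ∀ x y, e ⁅x, y⁆ - (⁅x, e y⁆ + ⁅e x, y⁆) ∈ ⁅radical F L, radical F L⁆ := by
  set R := radical F L with hR
  set R' : LieIdeal F L := ⁅R, R⁆ with hR'
  let M := R ⧸ LieSubmodule.comap (LieSubmodule.incl R) R'
  let π : R →ₗ⁅F, L⁆ M := LieSubmodule.Quotient.mk' _
  have hπ : Function.Surjective π := LieSubmodule.Quotient.surjective_mk' _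
  have hπ0 : ∀ r : R, π r = 0 ↔ (r : L) ∈ R' := fun r =>
    LieSubmodule.Quotient.mk_eq_zero' (N := LieSubmodule.comap (LieSubmodule.incl R) R')
  have hRM : ∀ r ∈ R, ∀ m : M, ⁅r, m⁆ = 0 := by
    intro r hr m
    obtain ⟨s, rfl⟩ := hπ m
    rw [← LieModuleHom.map_lie, hπ0]
    exact LieSubmodule.lie_mem_lie hr s.2
  have hinv : ∀ m : M, (∀ x : L, ⁅x, m⁆ = 0) → m = 0 := by
    intro m hm
    obtain ⟨s, rfl⟩ := hπ m
    rw [hπ0]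
    refine LieModule.mem_of_lie_mem_of_mem_lie (C := R)
      (fun r hr s hs => LieSubmodule.lie_mem_lie hr hs) (by rw [hLR]; exact s.2) fun x => ?_
    have := hm x
    rwa [← LieModuleHom.map_lie, hπ0] at this
  let δ : M →ₗ⁅F, L⁆ (L →ₗ[F] M) :=
    { toFun := fun m => (toEnd F L M : L →ₗ[F] Module.End F M).flip m
      map_add' := fun a b => map_add _ a b
      map_smul' := fun a b => map_smul _ a b
      map_lie' := by
        intro y m
        ext x
        change ⁅x, ⁅y, m⁆⁆ = ⁅y, ⁅x, m⁆⁆ - ⁅⁅y, x⁆, m⁆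
        rw [leibniz_lie y x]
        abel }
  have hδ : ∀ m x, δ m x = ⁅x, m⁆ := fun _ _ => rfl
  have hδi : Function.Injective δ := by
    rw [injective_iff_map_eq_zero]
    intro m hm
    exact hinv m fun x => LinearMap.congr_fun hm x
  have hlie : ∀ (y : L) (φ : L →ₗ[F] M) (x : L), ⁅y, φ⁆ x = ⁅y, φ x⁆ - φ ⁅y, x⁆ := fun _ _ _ => rfl
  let C : LieSubmodule F L (L →ₗ[F] M) :=
    { carrier := {φ | ∃ t : F, ∀ r : R, φ r = t • π r}
      add_mem' := by
        rintro φ ψ ⟨t, ht⟩ ⟨u, hu⟩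
        exact ⟨t + u, fun r => by rw [LinearMap.add_apply, ht, hu, add_smul]⟩
      zero_mem' := ⟨0, fun r => by simp⟩
      smul_mem' := by
        rintro a φ ⟨t, ht⟩
        exact ⟨a * t, fun r => by rw [LinearMap.smul_apply, ht, mul_smul]⟩
      lie_mem := by
        rintro y φ ⟨t, ht⟩
        refine ⟨0, fun r => ?_⟩
        have := ht ⁅y, r⁆
        rw [LieSubmodule.coe_bracket] at this
        rw [hlie, ht, this, LieModuleHom.map_lie, lie_smul, sub_self, zero_smul] }
  have hCL : ∀ φ ∈ ⁅(⊤ : LieIdeal F L), C⁆, ∀ r : R, φ r = 0 := by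
    intro φ hφ r
    rw [← LieSubmodule.mem_toSubmodule, LieSubmodule.lieIdeal_oper_eq_linear_span] at hφ
    induction hφ using Submodule.span_induction with
    | mem w hw =>
      obtain ⟨⟨y, _⟩, ⟨φ, t, ht⟩, rfl⟩ := hw
      have := ht ⁅y, r⁆
      rw [LieSubmodule.coe_bracket] at this
      change ⁅y, φ⁆ (r : L) = 0
      rw [hlie, ht, this, LieModuleHom.map_lie, lie_smul, sub_self]
    | zero => simp
    | add a b _ _ ha hb => simp [ha, hb]
    | smul t a _ ha => simp [ha]
  have hRδ : ∀ (r : R) (φ : L →ₗ[F] M) (t : F), (∀ s : R, φ s = t • π s) →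
      ⁅(r : L), φ⁆ = δ (t • π r) := by
    intro r φ t ht
    ext x
    have h1 := ht ⁅x, r⁆
    rw [LieSubmodule.coe_bracket] at h1
    rw [hlie, hRM r r.2, zero_sub, ← lie_skew, map_neg, h1, hδ, neg_neg, lie_smul,
      LieModuleHom.map_lie]
  obtain ⟨φ₀, hφ₀⟩ := LinearMap.exists_extend (p := R.toSubmodule) (π : R →ₗ[F] M)
  have hφ₀' : ∀ r : R, φ₀ r = π r := fun r => LinearMap.congr_fun hφ₀ r
  obtain ⟨φ, hφC, hφ1, hφ2⟩ := LieModule.exists_sub_mem_lie_and_lie_mem (C := C) (N := δ.range)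
    (by
      rintro r hr φ ⟨t, ht⟩
      exact ⟨_, (hRδ ⟨r, hr⟩ φ t ht).symm⟩) (v := φ₀) ⟨1, fun r => by rw [hφ₀', one_smul]⟩
  have hφπ : ∀ r : R, φ r = (1 : F) • π r := fun r => by
    have := hCL _ hφ1 r
    rw [LinearMap.sub_apply, sub_eq_zero, hφ₀'] at this
    rw [one_smul, this]
  choose m hm using hφ2
  have hm : ∀ x, δ (m x) = ⁅x, φ⁆ := hm
  have hmlie : ∀ x y, m ⁅x, y⁆ = ⁅x, m y⁆ - ⁅y, m x⁆ := fun x y => hδi <| by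
    rw [hm, map_sub, LieModuleHom.map_lie, LieModuleHom.map_lie, hm, hm, lie_lie]
  obtain ⟨s, hs⟩ := LinearMap.exists_rightInverse_of_surjective (π : R →ₗ[F] M)
    (LinearMap.range_eq_top.2 hπ)
  have hs : ∀ m, π (s m) = m := fun m => LinearMap.congr_fun hs m
  let mL : L →ₗ[F] M :=
    { toFun := m
      map_add' := fun x y => hδi <| by rw [hm, map_add, hm, hm, add_lie]
      map_smul' := fun a x => hδi <| by rw [hm, RingHom.id_apply, map_smul, hm, smul_lie] }
  refine ⟨R.toSubmodule.subtype ∘ₗ s ∘ₗ mL, fun x => (s (m x)).2, fun r hr => ?_, fun x y => ?_⟩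
  · have h : π (s (m r) - ⟨r, hr⟩) = 0 := by
      rw [map_sub, hs, sub_eq_zero]
      apply hδi
      rw [hm, hRδ ⟨r, hr⟩ φ 1 hφπ, one_smul]
    exact (hπ0 _).1 h
  · have h : π (s (m ⁅x, y⁆) - (⁅x, s (m y)⁆ - ⁅y, s (m x)⁆)) = 0 := by
      rw [map_sub, map_sub, LieModuleHom.map_lie, LieModuleHom.map_lie, hs, hs, hs, hmlie, sub_self]
    have := (hπ0 _).1 h
    rw [← lie_skew (((R.toSubmodule.subtype ∘ₗ s ∘ₗ mL) x)) y, ← sub_eq_add_neg]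
    exact this

end

section

variable {G F L : Type*} [Group G] [Fintype G] [Field F] [LieRing L] [LieAlgebra F L]
  {p : G → L →ₗ[F] L}

theorem IsGradingProj.proj_lie_left (hp : IsGradingProj p) (a b : G) (x z : L) :
    p (a * b) ⁅p a x, z⁆ = ⁅p a x, p b z⁆ := by
  rw [hp.proj_lie, Finset.sum_eq_single a, hp.self, inv_mul_cancel_left]
  · intro h _ hh
    rw [hp.ne _ _ _ hh, zero_lie]
  · simp

theorem IsGradingProj.proj_lie_right (hp : IsGradingProj p) (a b : G) (z y : L) :
    p (a * b) ⁅z, p b y⁆ = ⁅p a z, p b y⁆ := by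
  rw [hp.proj_lie, Finset.sum_eq_single a, inv_mul_cancel_left, hp.self]
  · intro h _ hh
    rw [hp.ne, lie_zero]
    intro h'
    apply hh
    rw [← mul_assoc, mul_eq_right] at h'
    rw [inv_mul_eq_one.1 h']
  · simp

theorem IsGradingProj.proj_mem_lie (hp : IsGradingProj p) {I J : LieIdeal F L}
    (hI : ∀ g, ∀ x ∈ I, p g x ∈ I) (hJ : ∀ g, ∀ x ∈ J, p g x ∈ J) (g : G) {x : L}
    (hx : x ∈ ⁅I, J⁆) : p g x ∈ ⁅I, J⁆ := by
  rw [← LieSubmodule.mem_toSubmodule, LieSubmodule.lieIdeal_oper_eq_linear_span] at hx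
  induction hx using Submodule.span_induction with
  | mem w hw =>
    obtain ⟨⟨y, hy⟩, ⟨z, hz⟩, rfl⟩ := hw
    rw [hp.proj_lie]
    exact sum_mem fun h _ => LieSubmodule.lie_mem_lie (hI _ _ hy) (hJ _ _ hz)
  | zero => rw [map_zero]; exact zero_mem _
  | add a b _ _ ha hb => rw [map_add]; exact add_mem ha hb
  | smul t a _ ha => rw [map_smul]; exact SMulMemClass.smul_mem _ ha

/-- A derivation modulo a graded ideal can be replaced by one preserving degrees. -/
theorem IsGradingProj.exists_commuting_derivation (hp : IsGradingProj p) {R R' : LieIdeal F L}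
    (hR : ∀ g, ∀ x ∈ R, p g x ∈ R) (hR' : ∀ g, ∀ x ∈ R', p g x ∈ R')
    (h : ∃ e : L →ₗ[F] L, (∀ x, e x ∈ R) ∧ (∀ r ∈ R, e r - r ∈ R') ∧
      ∀ x y, e ⁅x, y⁆ - (⁅x, e y⁆ + ⁅e x, y⁆) ∈ R') :
    ∃ e : L →ₗ[F] L, (∀ x, e x ∈ R) ∧ (∀ r ∈ R, e r - r ∈ R') ∧
      (∀ x y, e ⁅x, y⁆ - (⁅x, e y⁆ + ⁅e x, y⁆) ∈ R') ∧ ∀ g x, e (p g x) = p g (e x) := by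
  obtain ⟨e, he1, he2, he3⟩ := h
  let f : L →ₗ[F] L := ∑ g, p g ∘ₗ e ∘ₗ p g
  have hf : ∀ x, f x = ∑ g, p g (e (p g x)) := fun x => by simp [f, LinearMap.sum_apply]
  have hfp : ∀ g x, f (p g x) = p g (e (p g x)) := fun g x => by
    rw [hf, Finset.sum_eq_single g, hp.self]
    · intro h _ hh
      rw [hp.ne _ _ _ hh, map_zero, map_zero]
    · simp
  refine ⟨f, fun x => ?_, fun r hr => ?_, fun x y => ?_, fun g x => ?_⟩
  · rw [hf]
    exact sum_mem fun g _ => hR _ _ (he1 _)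
  · have : f r - r = ∑ g, p g (e (p g r) - p g r) := by
      simp_rw [map_sub, hp.self, Finset.sum_sub_distrib, hp.sum, hf]
    rw [this]
    exact sum_mem fun g _ => hR' _ _ (he2 _ (hR _ _ hr))
  · have key : ∀ a b, f ⁅p a x, p b y⁆ - (⁅p a x, f (p b y)⁆ + ⁅f (p a x), p b y⁆) ∈ R' := by
      intro a b
      have h1 := hR' (a * b) _ (he3 (p a x) (p b y))
      rw [map_sub, map_add, hp.proj_lie_left, hp.proj_lie_right] at h1
      rwa [← hp.lie a b, hfp, hfp, hfp, hp.lie a b]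
    have : f ⁅x, y⁆ - (⁅x, f y⁆ + ⁅f x, y⁆) =
        ∑ a, ∑ b, (f ⁅p a x, p b y⁆ - (⁅p a x, f (p b y)⁆ + ⁅f (p a x), p b y⁆)) := by
      conv_lhs => rw [← hp.sum x, ← hp.sum y]
      simp only [map_sum, sum_lie, Finset.sum_sub_distrib, Finset.sum_add_distrib]
      simp only [map_sum, lie_sum]
    rw [this]
    exact sum_mem fun a _ => sum_mem fun b _ => key a b
  · rw [hfp, hf, map_sum, Finset.sum_eq_single g, hp.self]
    · intro h _ hh
      rw [hp.ne _ _ _ hh.symm]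
    · simp

/-- If the radical is nonzero, there is a proper graded subalgebra which together with the radical
spans. -/
theorem IsGradingProj.exists_subalgebra_sup_radical [IsAlgClosed F] [CharZero F]
    [FiniteDimensional F L] (hp : IsGradingProj p) (hR : radical F L ≠ ⊥) :
    ∃ B : LieSubalgebra F L, B ≠ ⊤ ∧ (∀ g, ∀ x ∈ B, p g x ∈ B) ∧
      ∀ x : L, ∃ b ∈ B, ∃ r ∈ radical F L, b + r = x := by
  have hRg : ∀ g, ∀ x ∈ radical F L, p g x ∈ radical F L := fun g x hx => hp.proj_mem_radical g hx
  obtain ⟨R', hR'R, hR'g, h⟩ : ∃ R' : LieIdeal F L, R' < radical F L ∧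
      (∀ g, ∀ x ∈ R', p g x ∈ R') ∧ ∃ e : L →ₗ[F] L, (∀ x, e x ∈ radical F L) ∧
      (∀ r ∈ radical F L, e r - r ∈ R') ∧ ∀ x y, e ⁅x, y⁆ - (⁅x, e y⁆ + ⁅e x, y⁆) ∈ R' := by
    by_cases hLR : ⁅(⊤ : LieIdeal F L), radical F L⁆ = radical F L
    · refine ⟨⁅radical F L, radical F L⁆, lt_of_le_of_ne (LieSubmodule.lie_le_right _ _) ?_,
        fun g x hx => hp.proj_mem_lie hRg hRg g hx, exists_derivation_of_lie_radical_radical hLR⟩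
      intro hRR
      apply hR
      obtain ⟨k, hk⟩ := (isSolvable_iff F (radical F L)).1 inferInstance
      rw [LieIdeal.derivedSeries_eq_bot_iff] at hk
      rw [← hk]
      clear hk
      induction k with
      | zero => rfl
      | succ k ih => rw [derivedSeriesOfIdeal_succ, ← ih, hRR]
    · exact ⟨_, lt_of_le_of_ne (LieSubmodule.lie_le_right _ _) hLR,
        fun g x hx => hp.proj_mem_lie (fun _ _ _ => LieSubmodule.mem_top _) hRg g hx,
        exists_derivation_of_lie_top_radical⟩
  obtain ⟨e, he1, he2, he3, he4⟩ := hp.exists_commuting_derivation hRg hR'g h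
  let B : LieSubalgebra F L :=
    { R'.toSubmodule.comap e with
      lie_mem' := by
        intro x y hx hy
        have h1 := add_mem (he3 x y) (add_mem (R'.lie_mem (x := x) (m := e y) hy)
          (lie_mem_left F L R' (e x) y hx))
        rwa [sub_add_cancel] at h1 }
  have hB : ∀ x, x ∈ B ↔ e x ∈ R' := fun x => Iff.rfl
  refine ⟨B, fun hBt => ?_, fun g x hx => ?_, fun x => ⟨x - e x, ?_, e x, he1 x, by abel⟩⟩
  · obtain ⟨r, hr, hr'⟩ := SetLike.exists_of_lt hR'R
    have : r ∈ B := by rw [hBt]; trivial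
    apply hr'
    have := sub_mem ((hB r).1 this) (he2 r hr)
    rwa [sub_sub_cancel] at this
  · rw [hB, he4]
    exact hR'g _ _ hx
  · rw [hB, map_sub, ← neg_sub]
    exact neg_mem (he2 _ (he1 x))

end

section

variable {F L : Type*} [Field F] [LieRing L] [LieAlgebra F L] [FiniteDimensional F L]

/-- A surjective homomorphism maps the radical into the radical. -/
theorem LieHom.apply_mem_radical_of_surjective {L' : Type*} [LieRing L'] [LieAlgebra F L']
    [FiniteDimensional F L'] {f : L →ₗ⁅F⁆ L'} (hf : Function.Surjective f) {x : L}
    (hx : x ∈ radical F L) : f x ∈ radical F L' := by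
  let g : radical F L →ₗ⁅F⁆ LieIdeal.map f (radical F L) :=
    { toFun := fun y => ⟨f y, LieIdeal.mem_map y.2⟩
      map_add' := fun y z => Subtype.ext (map_add f (y : L) z)
      map_smul' := fun a y => Subtype.ext (map_smul f a (y : L))
      map_lie' := fun {y z} => Subtype.ext (map_lie f (y : L) z) }
  have hg : Function.Surjective g := by
    rintro ⟨y, hy⟩
    obtain ⟨z, hz⟩ := LieIdeal.mem_map_of_surjective hf hy
    exact ⟨z, Subtype.ext hz⟩
  have := hg.lieAlgebra_isSolvable
  exact (LieIdeal.solvable_iff_le_radical F L' _).1 this (LieIdeal.mem_map hx)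

theorem LieSubalgebra.coe_mem_radical_of_sup_radical {B : LieSubalgebra F L}
    (hB : ∀ x : L, ∃ b ∈ B, ∃ r ∈ radical F L, b + r = x) {x : B} (hx : x ∈ radical F B) :
    (x : L) ∈ radical F L := by
  let π : L →ₗ⁅F⁆ L ⧸ radical F L :=
    { (LieSubmodule.Quotient.mk' (radical F L) : L →ₗ[F] L ⧸ radical F L) with
      map_lie' := fun {x y} => rfl }
  have hπ : ∀ x, π x = 0 ↔ x ∈ radical F L := fun x => LieSubmodule.Quotient.mk_eq_zero'
  have hf : Function.Surjective (π.comp B.incl) := by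
    intro y
    obtain ⟨x, rfl⟩ := LieSubmodule.Quotient.surjective_mk' _ y
    obtain ⟨b, hb, r, hr, rfl⟩ := hB x
    refine ⟨⟨b, hb⟩, ?_⟩
    change π b = π (b + r)
    rw [map_add, (hπ r).2 hr, add_zero]
  have := LieHom.apply_mem_radical_of_surjective hf hx
  have h0 : radical F (L ⧸ radical F L) = ⊥ := HasTrivialRadical.radical_eq_bot
  rw [h0, LieSubmodule.mem_bot] at this
  exact (hπ _).1 this

theorem LieSubalgebra.mem_radical_of_coe_mem_radical {B : LieSubalgebra F L} {x : B}
    (hx : (x : L) ∈ radical F L) : x ∈ radical F B := by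
  let g : LieIdeal.comap B.incl (radical F L) →ₗ⁅F⁆ radical F L :=
    { toFun := fun y => ⟨y, y.2⟩
      map_add' := fun _ _ => rfl
      map_smul' := fun _ _ => rfl
      map_lie' := rfl }
  have hg : Function.Injective g := fun y z h =>
    Subtype.ext (Subtype.ext (congrArg (fun w : radical F L => (w : L)) h))
  have := hg.lieAlgebra_isSolvable
  exact (LieIdeal.solvable_iff_le_radical F B _).1 this hx

/-- A graded **Levi decomposition**. -/
theorem IsGradingProj.exists_levi {G : Type*} [Group G] [Fintype G] [IsAlgClosed F] [CharZero F]
    {p : G → L →ₗ[F] L} (hp : IsGradingProj p) :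
    ∃ B : LieSubalgebra F L, (∀ g, ∀ x ∈ B, p g x ∈ B) ∧ radical F B = ⊥ ∧
      IsCompl B.toSubmodule (radical F L).toSubmodule := by
  suffices h : ∀ (n : ℕ) (B : LieSubalgebra F L), Module.finrank F B = n →
      (∀ g, ∀ x ∈ B, p g x ∈ B) → (∀ x : L, ∃ b ∈ B, ∃ r ∈ radical F L, b + r = x) →
      ∃ B : LieSubalgebra F L, (∀ g, ∀ x ∈ B, p g x ∈ B) ∧ radical F B = ⊥ ∧
        IsCompl B.toSubmodule (radical F L).toSubmodule from
    h _ ⊤ rfl (fun _ _ _ => trivial) fun x => ⟨x, trivial, 0, zero_mem _, add_zero x⟩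
  intro n
  induction n using Nat.strong_induction_on with
  | _ n ih =>
  intro B hn hBg hBR
  by_cases hB : radical F B = ⊥
  · refine ⟨B, hBg, hB, ?_, ?_⟩
    · rw [Submodule.disjoint_def]
      intro x hx hxR
      have := LieSubalgebra.mem_radical_of_coe_mem_radical (x := ⟨x, hx⟩) hxR
      rw [hB, LieSubmodule.mem_bot] at this
      exact congrArg Subtype.val this
    · rw [codisjoint_iff, eq_top_iff]
      exact fun x _ => Submodule.mem_sup.2 (hBR x)
  · obtain ⟨B', hB', hB'g, hB'R⟩ := (hp.restrict B hBg).exists_subalgebra_sup_radical hB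
    refine ih (Module.finrank F B') ?_ (B'.map B.incl) ?_ ?_ ?_
    · rw [← hn]
      refine Submodule.finrank_lt (s := B'.toSubmodule) fun h => hB' ?_
      rw [← LieSubalgebra.toSubmodule_inj, h]
      rfl
    · exact (LinearEquiv.finrank_eq (Submodule.equivMapOfInjective B.toSubmodule.subtype
        Subtype.val_injective B'.toSubmodule)).symm
    · rintro g _ ⟨x, hx, rfl⟩
      exact ⟨_, hB'g g x hx, rfl⟩
    · intro x
      obtain ⟨b, hb, r, hr, rfl⟩ := hBR x
      obtain ⟨c, hc, s, hs, h⟩ := hB'R ⟨b, hb⟩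
      refine ⟨c, ⟨c, hc, rfl⟩, s + r,
        add_mem (LieSubalgebra.coe_mem_radical_of_sup_radical hBR hs) hr, ?_⟩
      rw [← add_assoc]
      exact congrArg (· + r) (congrArg Subtype.val h)

end

section

variable {F L : Type*} [Field F] [LieRing L] [LieAlgebra F L]

theorem LieIdeal.le_killingCompl_of_disjoint {I J : LieIdeal F L} (h : Disjoint I J) :
    J ≤ LieIdeal.killingCompl F L I := by
  intro x hx
  rw [LieIdeal.mem_killingCompl]
  intro y hy
  rw [killingForm_apply_apply]
  have : ad F L y ∘ₗ ad F L x = 0 := by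
    ext z
    have hz : ⁅x, z⁆ ∈ J := lie_mem_left F L J x z hx
    have : ⁅y, ⁅x, z⁆⁆ ∈ I ⊓ J :=
      ⟨lie_mem_left F L I y _ hy, lie_mem_right F L J y _ hz⟩
    rw [h.eq_bot] at this
    exact this
  rw [this, map_zero]

theorem IsGradingProj.restrict_ideal {G : Type*} [Group G] [Fintype G]
    {p : G → L →ₗ[F] L} (hp : IsGradingProj p) (H : LieIdeal F L)
    (hH : ∀ g, ∀ x ∈ H, p g x ∈ H) :
    IsGradingProj (L := H) fun g => (p g).restrict (p := H.toSubmodule) (q := H.toSubmodule)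
      (hH g) where
  self g x := Subtype.ext (hp.self g x)
  ne g h x hgh := Subtype.ext (hp.ne g h x hgh)
  sum x := Subtype.ext <| by
    refine Eq.trans ?_ (hp.sum x)
    exact map_sum H.toSubmodule.subtype _ _
  lie g h x y := Subtype.ext (hp.lie g h x y)

variable [FiniteDimensional F L]

theorem LieIdeal.exists_isInternal_of_sSupIndep {S : Set (LieIdeal F L)} (h : sSupIndep S)
    (h' : sSup S = ⊤) : ∃ (m : ℕ) (H : Fin m → LieIdeal F L),
      DirectSum.IsInternal (fun i => (H i).toSubmodule) ∧ ∀ i, H i ∈ S := by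
  have hfin : Finite S := WellFoundedGT.finite_of_sSupIndep h
  obtain ⟨m, ⟨e⟩⟩ := Finite.exists_equiv_fin S
  refine ⟨m, fun i => (e.symm i : LieIdeal F L), ?_, fun i => (e.symm i).2⟩
  rw [DirectSum.isInternal_submodule_iff_iSupIndep_and_iSup_eq_top]
  constructor
  · rw [LieSubmodule.iSupIndep_toSubmodule]
    exact ((sSupIndep_iff S).1 h).comp e.symm.injective
  · rw [← LieSubmodule.iSup_toSubmodule, Equiv.iSup_comp (g := fun s : S => (s : LieIdeal F L)),
      ← sSup_eq_iSup', h', LieSubmodule.top_toSubmodule]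

/-- Ideals of an ideal of a Killing Lie algebra are ideals of the whole algebra. -/
theorem LieIdeal.exists_ideal_of_ideal [IsKilling F L] {H : LieIdeal F L} (J : LieIdeal F H) :
    ∃ K : LieIdeal F L, ∀ x, x ∈ K ↔ ∃ y ∈ J, (y : L) = x := by
  refine ⟨{ J.toSubmodule.map H.toSubmodule.subtype with lie_mem := ?_ }, fun x => Iff.rfl⟩
  rintro x _ ⟨y, hy, rfl⟩
  obtain ⟨a, ha, b, hb, rfl⟩ : ∃ a ∈ H, ∃ b ∈ LieIdeal.killingCompl F L H, a + b = x := by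
    have : x ∈ H ⊔ LieIdeal.killingCompl F L H := by
      rw [(LieIdeal.isCompl_killingCompl H).sup_eq_top]
      trivial
    exact (LieSubmodule.mem_sup _ _ _).1 this
  refine ⟨⁅(⟨a, ha⟩ : H), y⁆, J.lie_mem hy, ?_⟩
  have hy' : (y : L) ∈ H := y.2
  have : ⁅b, (y : L)⁆ ∈ H ⊓ LieIdeal.killingCompl F L H :=
    ⟨lie_mem_right F L H b _ hy', lie_mem_left F L _ b _ hb⟩
  rw [(LieIdeal.isCompl_killingCompl H).inf_eq_bot, LieSubmodule.mem_bot] at this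
  change ⁅a, (y : L)⁆ = ⁅a + b, (y : L)⁆
  rw [add_lie, this, add_zero]

theorem LieIdeal.hasTrivialRadical_of_isKilling [IsKilling F L] (H : LieIdeal F L) :
    HasTrivialRadical F H := by
  rw [hasTrivialRadical_iff_no_abelian_ideals]
  intro J hJ
  obtain ⟨K, hK⟩ := LieIdeal.exists_ideal_of_ideal J
  have : IsLieAbelian K := by
    refine ⟨?_⟩
    rintro ⟨x, hx⟩ ⟨y, hy⟩
    obtain ⟨x, hx', rfl⟩ := (hK _).1 hx
    obtain ⟨y, hy', rfl⟩ := (hK _).1 hy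
    have := hJ.trivial ⟨x, hx'⟩ ⟨y, hy'⟩
    exact Subtype.ext (congrArg (fun z : J => ((z : H) : L)) this)
  have hb := IsKilling.ideal_eq_bot_of_isLieAbelian K
  rw [eq_bot_iff]
  intro x hx
  have := (hK x).2 ⟨x, hx, rfl⟩
  rw [hb, LieSubmodule.mem_bot] at this
  exact Subtype.ext this

variable {G : Type*} [Group G] [Fintype G] {p : G → L →ₗ[F] L}

theorem IsGradingProj.proj_mem_killingCompl (hp : IsGradingProj p) {I : LieIdeal F L}
    (hI : ∀ g, ∀ x ∈ I, p g x ∈ I) (g : G) {x : L} (hx : x ∈ LieIdeal.killingCompl F L I) :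
    p g x ∈ LieIdeal.killingCompl F L I := by
  rw [LieIdeal.mem_killingCompl] at hx ⊢
  intro y hy
  rw [← inv_inv g, ← hp.killingForm_proj]
  exact hx _ (hI _ _ hy)

/-- A graded Killing Lie algebra is the direct sum of its minimal graded ideals. -/
theorem IsGradingProj.exists_isInternal_minimal [IsKilling F L] (hp : IsGradingProj p) :
    ∃ (m : ℕ) (H : Fin m → LieIdeal F L), DirectSum.IsInternal (fun i => (H i).toSubmodule) ∧
      ∀ i, (∀ g, ∀ x ∈ H i, p g x ∈ H i) ∧ H i ≠ ⊥ ∧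
        ∀ I : LieIdeal F L, (∀ g, ∀ x ∈ I, p g x ∈ I) → I ≤ H i → I = ⊥ ∨ I = H i := by
  let M : Set (LieIdeal F L) := {H | (∀ g, ∀ x ∈ H, p g x ∈ H) ∧ H ≠ ⊥ ∧
    ∀ I : LieIdeal F L, (∀ g, ∀ x ∈ I, p g x ∈ I) → I ≤ H → I = ⊥ ∨ I = H}
  refine LieIdeal.exists_isInternal_of_sSupIndep (S := M) ?_ ?_
  · intro H hH
    refine (LieIdeal.isCompl_killingCompl H).disjoint.mono_right (sSup_le fun K hK => ?_)
    refine LieIdeal.le_killingCompl_of_disjoint (disjoint_iff.2 ?_)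
    have hg : ∀ g, ∀ x ∈ H ⊓ K, p g x ∈ H ⊓ K :=
      fun g x hx => ⟨hH.1 g x hx.1, hK.1.1 g x hx.2⟩
    refine (hH.2.2 _ hg inf_le_left).resolve_right fun h1 => ?_
    refine (hK.1.2.2 _ hg inf_le_right).elim (fun h2 => hH.2.1 (h1.symm.trans h2))
      fun h2 => hK.2 (h2.symm.trans h1)
  · have hS : ∀ g, ∀ x ∈ sSup M, p g x ∈ sSup M := by
      intro g x hx
      rw [sSup_eq_iSup'] at hx
      refine LieSubmodule.iSup_induction (motive := fun x => p g x ∈ sSup M) _ hx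
        (fun H y hy => ?_) ?_ fun y z hy hz => ?_
      · exact (le_sSup H.2 : (H : LieIdeal F L) ≤ sSup M) (H.2.1 g y hy)
      · rw [map_zero]
        exact zero_mem _
      · rw [map_add]
        exact add_mem hy hz
    have hC : LieIdeal.killingCompl F L (sSup M) = ⊥ := by
      by_contra hne
      have := LieSubmodule.wellFoundedLT_of_isArtinian F L L
      obtain ⟨H, ⟨hHg, hH0, hHC⟩, hmin⟩ := wellFounded_lt.has_min
        {H : LieIdeal F L | (∀ g, ∀ x ∈ H, p g x ∈ H) ∧ H ≠ ⊥ ∧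
          H ≤ LieIdeal.killingCompl F L (sSup M)}
        ⟨_, fun g x hx => hp.proj_mem_killingCompl hS g hx, hne, le_rfl⟩
      have hHM : H ∈ M := by
        refine ⟨hHg, hH0, fun I hI hIH => ?_⟩
        by_contra! hI'
        exact hmin I ⟨hI, hI'.1, hIH.trans hHC⟩ (lt_of_le_of_ne hIH hI'.2)
      exact hH0 (eq_bot_iff.2 ((LieIdeal.isCompl_killingCompl (sSup M)).disjoint.le_bot.trans'
        (le_inf (le_sSup hHM) hHC)))
    have := (LieIdeal.isCompl_killingCompl (sSup M)).sup_eq_top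
    rwa [hC, sup_bot_eq] at this

end

section

variable {G F L : Type*} [Group G] [Fintype G] [Field F] [LieRing L] [LieAlgebra F L]
  {p : G → L →ₗ[F] L}

theorem IsGradingProj.lie_eq_zero_of_ne (hp : IsGradingProj p) {g h : G} (hgh : g * h ≠ h * g)
    (x y : L) : ⁅p g x, p h y⁆ = 0 := by
  rw [← hp.lie, ← lie_skew, ← hp.lie, map_neg, hp.ne _ _ _ hgh, neg_zero]

/-- The support of a graded simple Lie algebra is commutative. -/
theorem IsGradingProj.commute_of_graded_simple (hp : IsGradingProj p)
    (hs : ∀ I : LieIdeal F L, (∀ g, ∀ x ∈ I, p g x ∈ I) → I = ⊥ ∨ I = ⊤) {g h : G} {x y : L}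
    (hx : p g x ≠ 0) (hy : p h y ≠ 0) : g * h = h * g := by
  let V : Submodule F L :=
    { carrier := {w | (∀ c, g * c ≠ c * g → p c w = 0) ∧
        ∀ k, g * k ≠ k * g → ∀ z, ⁅p k z, w⁆ = 0}
      zero_mem' := ⟨fun c _ => map_zero _, fun k _ z => lie_zero _⟩
      add_mem' := fun {a b} ha hb => ⟨fun c hc => by rw [map_add, ha.1 c hc, hb.1 c hc, add_zero],
        fun k hk z => by rw [lie_add, ha.2 k hk, hb.2 k hk, add_zero]⟩
      smul_mem' := fun t a ha => ⟨fun c hc => by rw [map_smul, ha.1 c hc, smul_zero],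
        fun k hk z => by rw [lie_smul, ha.2 k hk, smul_zero]⟩ }
  have hmul : ∀ a b, g * a = a * g → g * b ≠ b * g → g * (a * b) ≠ a * b * g := by
    intro a b ha hb h
    apply hb
    have : a * (g * b) = a * (b * g) := by rw [← mul_assoc, ← ha, mul_assoc, h, mul_assoc]
    exact mul_left_cancel this
  have hmul' : ∀ a b, g * a = a * g → g * b ≠ b * g → g * (b * a) ≠ b * a * g := by
    intro a b ha hb h
    apply hb
    have : g * b * a = b * g * a := by rw [mul_assoc, h, mul_assoc, ← ha, mul_assoc]
    exact mul_right_cancel this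
  have hV : ∀ k z, ∀ w ∈ V, ⁅p k z, w⁆ ∈ V := by
    intro k z w hw
    by_cases hk : g * k = k * g
    · refine ⟨fun c hc => ?_, fun l hl u => ?_⟩
      · rw [show c = k * (k⁻¹ * c) by group, hp.proj_lie_left, hw.1, lie_zero]
        exact hmul _ _ (Commute.inv_right (show Commute g k from hk)).eq hc
      · rw [leibniz_lie, hw.2 l hl, lie_zero, add_zero, ← hp.lie]
        exact hw.2 _ (hmul' _ _ hk hl) _
    · rw [hw.2 k hk]
      exact zero_mem V
  let I : LieIdeal F L :=
    { V with
      lie_mem := fun {z w} hw => by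
        change ⁅z, w⁆ ∈ V
        rw [← hp.sum z, sum_lie]
        exact sum_mem fun k _ => hV k z w hw }
  have hI : ∀ k, ∀ w ∈ I, p k w ∈ I := by
    intro k w hw
    refine ⟨fun c hc => ?_, fun l hl z => ?_⟩
    · by_cases hck : c = k
      · rw [← hck, hw.1 c hc, map_zero]
      · exact hp.ne _ _ _ hck
    · rw [← hp.proj_lie_left, hw.2 l hl, map_zero]
  have hxI : p g x ∈ I := by
    refine ⟨fun c hc => hp.ne _ _ _ ?_, fun k hk z => hp.lie_eq_zero_of_ne (Ne.symm hk) _ _⟩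
    rintro rfl
    exact hc rfl
  have hyI : y ∈ I := by
    rcases hs I hI with h0 | h1
    · rw [h0, LieSubmodule.mem_bot] at hxI
      exact absurd hxI hx
    · rw [h1]
      trivial
  by_contra hgh
  exact hy (hyI.1 h hgh)

end

section

variable {G F L : Type*} [CommGroup G] [Fintype G] [Field F] [LieRing L] [LieAlgebra F L]
  {p : G → L →ₗ[F] L}

/-- The automorphism of a graded Lie algebra defined by a character of the grading group. -/
noncomputable def IsGradingProj.charEquiv (hp : IsGradingProj p) (χ : G →* Fˣ) : L ≃ₗ⁅F⁆ L :=
  have h1 : ∀ (χ ψ : G →* Fˣ) (x : L),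
      (∑ g, (χ g : F) • p g) ((∑ g, (ψ g : F) • p g) x) = ∑ g, ((χ * ψ) g : F) • p g x := by
    intro χ ψ x
    simp only [LinearMap.sum_apply, LinearMap.smul_apply, map_sum, map_smul]
    refine Finset.sum_congr rfl fun g _ => ?_
    rw [Finset.sum_eq_single g, hp.self, smul_smul, MonoidHom.mul_apply, Units.val_mul, mul_comm]
    · intro h _ hh
      rw [hp.ne _ _ _ hh, smul_zero]
    · simp
  have h2 : ∀ x : L, ∑ g, ((1 : G →* Fˣ) g : F) • p g x = x := by
    intro x
    simpa using hp.sum x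
  { (∑ g, (χ g : F) • p g : L →ₗ[F] L) with
    invFun := (∑ g, (χ⁻¹ g : F) • p g : L →ₗ[F] L)
    left_inv := fun x => by
      change (∑ g, (χ⁻¹ g : F) • p g) ((∑ g, (χ g : F) • p g) x) = x
      rw [h1, show χ⁻¹ * χ = 1 from inv_mul_cancel χ, h2]
    right_inv := fun x => by
      change (∑ g, (χ g : F) • p g) ((∑ g, (χ⁻¹ g : F) • p g) x) = x
      rw [h1, show χ * χ⁻¹ = 1 from mul_inv_cancel χ, h2]
    map_lie' := fun {x y} => by
      change (∑ g, (χ g : F) • p g) ⁅x, y⁆ =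
        ⁅(∑ g, (χ g : F) • p g) x, (∑ g, (χ g : F) • p g) y⁆
      simp only [LinearMap.sum_apply, LinearMap.smul_apply, sum_lie, lie_sum, hp.proj_lie,
        Finset.smul_sum, smul_lie, lie_smul]
      rw [Finset.sum_comm]
      conv_rhs => rw [Finset.sum_comm]
      refine Finset.sum_congr rfl fun g _ => ?_
      rw [← Equiv.sum_comp (Equiv.mulLeft g)]
      refine Finset.sum_congr rfl fun h _ => ?_
      rw [Equiv.coe_mulLeft, inv_mul_cancel_left, map_mul, Units.val_mul, smul_smul,
        mul_comm] }

theorem IsGradingProj.charEquiv_apply (hp : IsGradingProj p) (χ : G →* Fˣ) (x : L) :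
    hp.charEquiv χ x = ∑ g, (χ g : F) • p g x := by
  change (∑ g, (χ g : F) • p g) x = _
  simp [LinearMap.sum_apply]

theorem IsGradingProj.charEquiv_mul (hp : IsGradingProj p) (χ ψ : G →* Fˣ) (x : L) :
    hp.charEquiv χ (hp.charEquiv ψ x) = hp.charEquiv (χ * ψ) x := by
  simp only [hp.charEquiv_apply, map_sum, map_smul]
  refine Finset.sum_congr rfl fun g _ => ?_
  rw [Finset.sum_eq_single g, hp.self, smul_smul, MonoidHom.mul_apply, Units.val_mul, mul_comm]
  · intro h _ hh
    rw [hp.ne _ _ _ hh.symm, smul_zero]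
  · simp

/-- A subspace which is stable under the characters is graded. -/
theorem IsGradingProj.proj_mem_of_charEquiv_mem [IsAlgClosed F] [CharZero F]
    (hp : IsGradingProj p) {V : Submodule F L} (hV : ∀ χ, ∀ x ∈ V, hp.charEquiv χ x ∈ V) (g : G)
    {x : L} (hx : x ∈ V) : p g x ∈ V := by
  classical
  have : Finite (G →* Fˣ) :=
    Finite.of_equiv _ (CommGroup.monoidHom_mulEquiv_of_hasEnoughRootsOfUnity G F).some.symm.toEquiv
  have := Fintype.ofFinite (G →* Fˣ)
  have horth : ∀ h : G, h ≠ 1 → ∑ χ : G →* Fˣ, (χ h : F) = 0 := by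
    intro h hh
    obtain ⟨ψ, hψ⟩ := CommGroup.exists_apply_ne_one_of_hasEnoughRootsOfUnity G F hh
    have h1 : (ψ h : F) * ∑ χ : G →* Fˣ, (χ h : F) = ∑ χ : G →* Fˣ, (χ h : F) := by
      rw [Finset.mul_sum, ← Equiv.sum_comp (Equiv.mulLeft ψ) fun χ : G →* Fˣ => (χ h : F)]
      refine Finset.sum_congr rfl fun χ _ => ?_
      rw [Equiv.coe_mulLeft, MonoidHom.mul_apply, Units.val_mul]
    by_contra h0
    exact hψ (Units.ext ((mul_eq_right₀ h0).1 h1))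
  have h1 : (Fintype.card (G →* Fˣ) : F) • p g x =
      ∑ χ : G →* Fˣ, (χ g⁻¹ : F) • hp.charEquiv χ x := by
    simp only [hp.charEquiv_apply, Finset.smul_sum, smul_smul]
    rw [Finset.sum_comm, Finset.sum_eq_single g]
    · rw [← Finset.sum_smul]
      congr 1
      simp
    · intro h _ hh
      rw [← Finset.sum_smul]
      convert zero_smul F (p h x)
      rw [← horth (g⁻¹ * h) fun h1 => hh (inv_mul_eq_one.1 h1).symm]
      refine Finset.sum_congr rfl fun χ _ => ?_
      rw [map_mul, Units.val_mul]
    · simp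
  have h2 : (Fintype.card (G →* Fˣ) : F) ≠ 0 := Nat.cast_ne_zero.2 Fintype.card_ne_zero
  rw [← V.smul_mem_iff h2, h1]
  exact sum_mem fun χ _ => V.smul_mem _ (hV χ x hx)

/-- In a Killing Lie algebra which is graded simple with respect to a commutative group, all
simple ideals are isomorphic. -/
theorem IsGradingProj.nonempty_equiv_of_isAtom [IsAlgClosed F] [CharZero F]
    [FiniteDimensional F L] [IsKilling F L] (hp : IsGradingProj p)
    (hs : ∀ I : LieIdeal F L, (∀ g, ∀ x ∈ I, p g x ∈ I) → I = ⊥ ∨ I = ⊤) {S T : LieIdeal F L}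
    (hS : IsAtom S) (hT : IsAtom T) : Nonempty (S ≃ₗ⁅F⁆ T) := by
  have hinv : ∀ (χ : G →* Fˣ) (x : L), hp.charEquiv χ (hp.charEquiv χ⁻¹ x) = x := by
    intro χ x
    rw [hp.charEquiv_mul, show χ * χ⁻¹ = 1 from mul_inv_cancel χ, hp.charEquiv_apply]
    simpa using hp.sum x
  have hinv' : ∀ (χ : G →* Fˣ) (x : L), hp.charEquiv χ⁻¹ (hp.charEquiv χ x) = x := by
    intro χ x
    rw [hp.charEquiv_mul, show χ⁻¹ * χ = 1 from inv_mul_cancel χ, hp.charEquiv_apply]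
    simpa using hp.sum x
  let c : (G →* Fˣ) → LieIdeal F L := fun χ => LieIdeal.comap (hp.charEquiv χ : L →ₗ⁅F⁆ L)
    (LieIdeal.killingCompl F L T)
  have hc : ∀ χ x, x ∈ c χ ↔ hp.charEquiv χ x ∈ LieIdeal.killingCompl F L T :=
    fun χ x => LieIdeal.mem_comap
  have hbot : ⨅ χ, c χ = ⊥ := by
    refine (hs (⨅ χ, c χ) fun g x hx => ?_).resolve_right fun h => ?_
    · refine hp.proj_mem_of_charEquiv_mem (V := (⨅ χ, c χ).toSubmodule) (fun ψ y hy => ?_) g hx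
      rw [LieSubmodule.mem_toSubmodule, LieSubmodule.mem_iInf] at hy ⊢
      intro χ
      rw [hc, hp.charEquiv_mul]
      exact (hc _ _).1 (hy (χ * ψ))
    · have h1 : c 1 = ⊤ := eq_top_iff.2 (h.ge.trans (iInf_le c 1))
      have h2 : LieIdeal.killingCompl F L T = ⊤ := by
        rw [eq_top_iff]
        intro x _
        have : x ∈ c 1 := h1 ▸ trivial
        rw [hc, hp.charEquiv_apply] at this
        have h3 := hp.sum x
        simp only [MonoidHom.one_apply, Units.val_one, one_smul, h3] at this
        exact this
      have := (LieIdeal.isCompl_killingCompl T).inf_eq_bot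
      rw [h2, inf_top_eq] at this
      exact hT.1 this
  obtain ⟨χ, hχ⟩ : ∃ χ, ¬ S ≤ c χ := by
    by_contra! h
    exact hS.1 (eq_bot_iff.2 ((le_iInf h).trans hbot.le))
  let S' : LieIdeal F L := LieIdeal.comap (hp.charEquiv χ⁻¹ : L →ₗ⁅F⁆ L) S
  have hS' : ∀ x, x ∈ S' ↔ hp.charEquiv χ⁻¹ x ∈ S := fun x => LieIdeal.mem_comap
  let T' : LieIdeal F L := LieIdeal.comap (hp.charEquiv χ : L →ₗ⁅F⁆ L) T
  have hT' : ∀ x, x ∈ T' ↔ hp.charEquiv χ x ∈ T := fun x => LieIdeal.mem_comap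
  have hne : S' ⊓ T ≠ ⊥ := by
    intro h
    refine hχ fun x hx => ?_
    rw [hc]
    refine LieIdeal.le_killingCompl_of_disjoint (I := T) (J := S')
      (disjoint_iff.2 (inf_comm S' T ▸ h)) ?_
    rw [hS', hinv']
    exact hx
  have hTS : T ≤ S' := by
    rcases hT.le_iff.1 (inf_le_right : S' ⊓ T ≤ T) with h | h
    · exact absurd h hne
    · rw [← h]
      exact inf_le_left
  have hST : S ≤ T' := by
    rcases hS.le_iff.1 (inf_le_left : S ⊓ T' ≤ S) with h | h
    · refine absurd (eq_bot_iff.2 fun x hx => ?_) hT.1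
      have : hp.charEquiv χ⁻¹ x ∈ S ⊓ T' := by
        refine ⟨(hS' x).1 (hTS hx), (hT' _).2 ?_⟩
        rwa [hinv]
      rw [h, LieSubmodule.mem_bot] at this
      rw [LieSubmodule.mem_bot, ← hinv χ x, this, map_zero]
    · rw [← h]
      exact inf_le_right
  exact ⟨{
    toFun := fun x => ⟨hp.charEquiv χ x, (hT' _).1 (hST x.2)⟩
    invFun := fun x => ⟨hp.charEquiv χ⁻¹ x, (hS' _).1 (hTS x.2)⟩
    map_add' := fun x y => Subtype.ext (map_add (hp.charEquiv χ) (x : L) y)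
    map_smul' := fun t x => Subtype.ext (map_smul (hp.charEquiv χ) t (x : L))
    map_lie' := fun {x y} => Subtype.ext (LieEquiv.map_lie (hp.charEquiv χ) (x : L) y)
    left_inv := fun x => Subtype.ext (hinv' χ x)
    right_inv := fun x => Subtype.ext (hinv χ x) }⟩

end

section

variable {G F L : Type*} [Group G] [Fintype G] [Field F] [LieRing L] [LieAlgebra F L]
  {p : G → L →ₗ[F] L}

/-- A graded Killing Lie algebra without proper graded ideals is a direct sum of pairwise
isomorphic simple ideals. -/
theorem IsGradingProj.exists_isInternal_isSimple [IsAlgClosed F] [CharZero F]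
    [FiniteDimensional F L] [IsKilling F L] (hp : IsGradingProj p)
    (hs : ∀ I : LieIdeal F L, (∀ g, ∀ x ∈ I, p g x ∈ I) → I = ⊥ ∨ I = ⊤) :
    ∃ (n : ℕ) (S : Fin n → LieIdeal F L), DirectSum.IsInternal (fun k => (S k).toSubmodule) ∧
      (∀ k, LieAlgebra.IsSimple F (S k)) ∧ ∀ k l, Nonempty (S k ≃ₗ⁅F⁆ S l) := by
  classical
  obtain ⟨n, S, hS, hatom⟩ := LieIdeal.exists_isInternal_of_sSupIndep
    (IsSemisimple.sSupIndep_isAtom (R := F) (L := L)) IsSemisimple.sSup_atoms_eq_top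
  refine ⟨n, S, hS, fun k => IsSemisimple.isSimple_of_isAtom _ (hatom k), fun k l => ?_⟩
  let s : Set G := {g | ∃ x, p g x ≠ 0}
  have hcomm : ∀ g ∈ s, ∀ h ∈ s, g * h = h * g := by
    rintro g ⟨x, hx⟩ h ⟨y, hy⟩
    exact hp.commute_of_graded_simple hs hx hy
  let _ : CommGroup (Subgroup.closure s) :=
    { (Subgroup.closure s).toGroup with
      mul_comm := (Subgroup.isMulCommutative_closure hcomm).is_comm.comm }
  have h0 : ∀ g, g ∉ Subgroup.closure s → ∀ x, p g x = 0 := by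
    intro g hg x
    by_contra hx
    exact hg (Subgroup.subset_closure ⟨x, hx⟩)
  have hp' : IsGradingProj fun g : Subgroup.closure s => p g :=
    { self := fun g => hp.self g
      ne := fun g h x hgh => hp.ne _ _ _ fun h1 => hgh (Subtype.ext h1)
      sum := fun x => by
        conv_rhs => rw [← hp.sum x]
        refine Finset.sum_of_injOn (fun g => (g : G)) Subtype.val_injective.injOn
          (fun _ _ => Finset.mem_coe.2 (Finset.mem_univ _)) (fun g _ hg => h0 g (fun h => hg ?_) x)
          fun _ _ => rfl
        exact ⟨⟨g, h⟩, Finset.mem_coe.2 (Finset.mem_univ _), rfl⟩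
      lie := fun g h => hp.lie g h }
  refine hp'.nonempty_equiv_of_isAtom (fun I hI => hs I fun g x hx => ?_) (hatom k) (hatom l)
  by_cases hg : g ∈ Subgroup.closure s
  · exact hI ⟨g, hg⟩ x hx
  · rw [h0 g hg]
    exact zero_mem _

end

/-- A minimal graded ideal has no proper graded ideals. -/
theorem IsGradingProj.eq_bot_or_eq_top_of_minimal {G F L : Type*} [Group G] [Fintype G] [Field F]
    [LieRing L] [LieAlgebra F L] [FiniteDimensional F L] [IsKilling F L] {p : G → L →ₗ[F] L}
    {H : LieIdeal F L} (hH : ∀ g, ∀ x ∈ H, p g x ∈ H)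
    (hmin : ∀ I : LieIdeal F L, (∀ g, ∀ x ∈ I, p g x ∈ I) → I ≤ H → I = ⊥ ∨ I = H)
    (J : LieIdeal F H)
    (hJ : ∀ g, ∀ x ∈ J, (p g).restrict (p := H.toSubmodule) (q := H.toSubmodule) (hH g) x ∈ J) :
    J = ⊥ ∨ J = ⊤ := by
  obtain ⟨K, hK⟩ := LieIdeal.exists_ideal_of_ideal J
  refine (hmin K ?_ ?_).imp (fun h => ?_) fun h => ?_
  · intro g x hx
    obtain ⟨y, hy, rfl⟩ := (hK _).1 hx
    exact (hK _).2 ⟨_, hJ g y hy, rfl⟩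
  · intro x hx
    obtain ⟨y, hy, rfl⟩ := (hK _).1 hx
    exact y.2
  · rw [eq_bot_iff]
    intro y hy
    have := (hK y).2 ⟨y, hy, rfl⟩
    rw [h, LieSubmodule.mem_bot] at this
    exact Subtype.ext this
  · rw [eq_top_iff]
    intro y _
    obtain ⟨z, hz, hzy⟩ := (hK y).1 (h ▸ y.2)
    exact Subtype.ext hzy ▸ hz

end

/-- Theorem 1: Let `L` be a finite dimensional Lie algebra over an
algebraically closed field of characteristic zero, graded by a finite group `G`. Then
(i) the solvable radical `Rad L` is a graded ideal; (ii) there is a Levi subalgebra `B`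
(a semisimple subalgebra with `L = B ⊕ Rad L` as vector spaces) homogeneous in the
grading; and (iii) `B = H₁ ⊕ ⋯ ⊕ Hₘ` is a direct sum of graded ideals, each graded
simple in the induced grading with commutative support, and each `Hᵢ`, as an ungraded
Lie algebra, is a direct sum of pairwise isomorphic simple ideals. -/
theorem graded_levi_decomposition {G F L : Type*} [Group G] [Finite G] [Field F]
    [IsAlgClosed F] [CharZero F] [LieRing L] [LieAlgebra F L] [FiniteDimensional F L]
    (𝒜 : G → Submodule F L) (hgr : IsLieGrading 𝒜) :
    IsGradedSubspace 𝒜 (LieAlgebra.radical F L).toSubmodule ∧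
    ∃ B : LieSubalgebra F L,
      IsGradedSubspace 𝒜 B.toSubmodule ∧
      LieAlgebra.radical F ↥B = ⊥ ∧
      IsCompl B.toSubmodule (LieAlgebra.radical F L).toSubmodule ∧
      IsLieGrading (fun g => ((𝒜 g).comap B.toSubmodule.subtype : Submodule F ↥B)) ∧
      ∃ (m : ℕ) (H : Fin m → LieIdeal F ↥B),
        DirectSum.IsInternal (fun i => (H i).toSubmodule) ∧
        ∀ i : Fin m,
          -- each `Hᵢ` is a graded ideal of `B`
          IsGradedSubspace (fun g => ((𝒜 g).comap B.toSubmodule.subtype : Submodule F ↥B))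
            (H i).toSubmodule ∧
          -- each `Hᵢ` is graded simple with respect to the induced grading
          IsGradedSimple (fun g =>
            (((𝒜 g).comap B.toSubmodule.subtype).comap (H i).toSubmodule.subtype :
              Submodule F ↥(H i))) ∧
          -- the support of `Hᵢ` is a commutative subset of `G`
          (∀ g h : G,
            ((𝒜 g).comap B.toSubmodule.subtype : Submodule F ↥B) ⊓ (H i).toSubmodule ≠ ⊥ →
            ((𝒜 h).comap B.toSubmodule.subtype : Submodule F ↥B) ⊓ (H i).toSubmodule ≠ ⊥ →
            g * h = h * g) ∧
          -- ungraded structure: direct sum of pairwise isomorphic simple ideals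
          ∃ (n : ℕ) (S : Fin n → LieIdeal F ↥(H i)),
            DirectSum.IsInternal (fun k => (S k).toSubmodule) ∧
            (∀ k, LieAlgebra.IsSimple F ↥(S k)) ∧
            ∀ k l, Nonempty (↥(S k) ≃ₗ⁅F⁆ ↥(S l)) := by
  cases nonempty_fintype G
  obtain ⟨p, hp, h𝒜⟩ := hgr.exists_isGradingProj
  refine ⟨(isGradedSubspace_iff hp h𝒜).2 fun g x hx => hp.proj_mem_radical g hx, ?_⟩
  obtain ⟨B, hB, hrad, hcompl⟩ := hp.exists_levi
  have hpB := hp.restrict B hB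
  have h𝒜B : ∀ (g : G) (x : B), x ∈ (𝒜 g).comap B.toSubmodule.subtype ↔
      (p g).restrict (p := B.toSubmodule) (q := B.toSubmodule) (hB g) x = x := by
    intro g x
    rw [Subtype.ext_iff]
    exact h𝒜 g x
  refine ⟨B, (isGradedSubspace_iff hp h𝒜).2 hB, hrad, hcompl, hpB.isLieGrading h𝒜B, ?_⟩
  have : LieAlgebra.HasTrivialRadical F B := ⟨hrad⟩
  obtain ⟨m, H, hH, hprop⟩ := hpB.exists_isInternal_minimal
  refine ⟨m, H, hH, fun i => ?_⟩
  obtain ⟨hHg, hH0, hmin⟩ := hprop i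
  have hpH := hpB.restrict_ideal (H i) hHg
  have h𝒜H : ∀ (g : G) (x : H i),
      x ∈ ((𝒜 g).comap B.toSubmodule.subtype).comap (H i).toSubmodule.subtype ↔
      LinearMap.restrict (p := (H i).toSubmodule) (q := (H i).toSubmodule) _ (hHg g) x = x := by
    intro g x
    rw [Subtype.ext_iff]
    exact h𝒜B g x
  have hs := IsGradingProj.eq_bot_or_eq_top_of_minimal hHg hmin
  have := LieIdeal.hasTrivialRadical_of_isKilling (H i)
  refine ⟨(isGradedSubspace_iff hpB h𝒜B).2 hHg, ⟨?_, fun I hI => hs I ?_⟩, fun g h hg hh => ?_,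
    hpH.exists_isInternal_isSimple hs⟩
  · by_contra! hab
    have : IsLieAbelian (H i) := ⟨hab⟩
    exact hH0 (LieAlgebra.IsKilling.ideal_eq_bot_of_isLieAbelian _)
  · exact (isGradedSubspace_iff hpH h𝒜H).1 hI
  · obtain ⟨x, hx, hx0⟩ := Submodule.exists_mem_ne_zero_of_ne_bot hg
    obtain ⟨y, hy, hy0⟩ := Submodule.exists_mem_ne_zero_of_ne_bot hh
    refine hpH.commute_of_graded_simple hs (x := ⟨x, hx.2⟩) (y := ⟨y, hy.2⟩) ?_ ?_
    · rw [(h𝒜H g ⟨x, hx.2⟩).1 hx.1]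
      exact fun h => hx0 (congrArg Subtype.val h)
    · rw [(h𝒜H h ⟨y, hy.2⟩).1 hy.1]
      exact fun h => hy0 (congrArg Subtype.val h)
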